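/- (gl_n q-binomial theorem I, Theorem 4.1 of the paper) For every composition v ∈ ℕ^n and every x ∈ ℂ^n there exists ε > 0 such that for all a ∈ ℂ with |a| < ε the family (a^{|u|} [u; v] 𝖬_u(x)), indexed by all compositions u ∈ ℕ^n, is absolutely summable and Σ_u a^{|u|} [u; v] 𝖬_u(x) = a^{|v|} 𝖬_v(x) · ∏_{i=1}^n (a⟨v⟩_i; q)_∞ / (a x_i; q)_∞. -/

import Mathlib

open scoped BigOperators
open MvPolynomial

noncomputable section
namespace LRW

variable {n : ℕ}

/-- `|u|`, the weight of a composition `u ∈ ℕⁿ`. -/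
def wt (u : Fin n → ℕ) : ℕ := ∑ i, u i

/-- `l'_u(i) = #{k > i : u_k > u_i} + #{k < i : u_k ≥ u_i}`. -/
def lp (u : Fin n → ℕ) (i : Fin n) : ℕ :=
  (Finset.univ.filter fun k => i < k ∧ u i < u k).card +
  (Finset.univ.filter fun k => k < i ∧ u i ≤ u k).card

/-- The spectral vector `⟨u⟩ : ⟨u⟩_i = q^{u_i} t^{n−1−l'_u(i)}`. -/
def spec (q t : ℂ) (u : Fin n → ℕ) : Fin n → ℂ :=
  fun i => q ^ u i * t ^ (n - 1 - lp u i)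

/-- Leg length `l(s)` of the cell `s = (i, j+1)` of `u` (so `j` ranges over
`0, …, u_i − 1`): `l(s) = #{k > i : j+1 ≤ u_k ≤ u_i} + #{k < i : j+1 ≤ u_k + 1 ≤ u_i}`. -/
def leg (u : Fin n → ℕ) (i : Fin n) (j : ℕ) : ℕ :=
  (Finset.univ.filter fun k => i < k ∧ j < u k ∧ u k ≤ u i).card +
  (Finset.univ.filter fun k => k < i ∧ j ≤ u k ∧ u k < u i).card

/-- `n(u) = Σ_{s ∈ u} l(s)`. -/
def nstat (u : Fin n → ℕ) : ℕ := ∑ i, ∑ j ∈ Finset.range (u i), leg u i j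

/-- `n'(u) = Σ_i C(u_i, 2)`. -/
def nstat' (u : Fin n → ℕ) : ℕ := ∑ i, Nat.choose (u i) 2

/-- `n(u⁺) = Σ_{i<j} min(u_i, u_j)`, the statistic `n` of the decreasing
rearrangement of `u`. -/
def nplus (u : Fin n → ℕ) : ℕ := ∑ i, ∑ j, if i < j then min (u i) (u j) else 0

/-- `τ_u = (−1)^{|u|} q^{n'(u)} t^{−n(u⁺)}`. -/
def tau (q t : ℂ) (u : Fin n → ℕ) : ℂ := (-1) ^ wt u * q ^ nstat' u / t ^ nplus u

/-- The generalized q-shifted factorial `(z)_u = ∏_{s ∈ u} (1 − z q^{a'(s)} t^{−l'(s)})`. -/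
def qfac (q t z : ℂ) (u : Fin n → ℕ) : ℂ :=
  ∏ i, ∏ j ∈ Finset.range (u i), (1 - z * q ^ j / t ^ lp u i)

/-- `c'_u = ∏_{s ∈ u} (1 − q^{a(s)+1} t^{l(s)})`. -/
def cp (q t : ℂ) (u : Fin n → ℕ) : ℂ :=
  ∏ i, ∏ j ∈ Finset.range (u i), (1 - q ^ (u i - j) * t ^ leg u i j)

/-- `M` is a family of interpolation Macdonald polynomials: `M u` has total degree
at most `|u|`, the coefficient of `x^u` in `M u` is `q^{−n'(u)}`, and `M u`
vanishes at `⟨v⟩` for every `v` with `|v| ≤ |u|`, `v ≠ u`. -/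
def IsInterpFamily (q t : ℂ) (M : (Fin n → ℕ) → MvPolynomial (Fin n) ℂ) : Prop :=
  ∀ u, (M u).totalDegree ≤ wt u ∧
    coeff (Finsupp.equivFunOnFinite.symm u) (M u) = (q ^ nstat' u)⁻¹ ∧
    ∀ v, wt v ≤ wt u → v ≠ u → eval (spec q t v) (M u) = 0

/-- `𝖬_u = q^{n'(u)} t^{n(u)} M_u / c'_u`. -/
def MM (q t : ℂ) (M : (Fin n → ℕ) → MvPolynomial (Fin n) ℂ) (u : Fin n → ℕ) :
    MvPolynomial (Fin n) ℂ :=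
  C (q ^ nstat' u * t ^ nstat u / cp q t u) * M u

/-- `𝖤_u = t^{n(u)} E_u / c'_u`, where `E_u` is the homogeneous component of
degree `|u|` of `M_u`. -/
def EE (q t : ℂ) (M : (Fin n → ℕ) → MvPolynomial (Fin n) ℂ) (u : Fin n → ℕ) :
    MvPolynomial (Fin n) ℂ :=
  C (t ^ nstat u / cp q t u) * homogeneousComponent (wt u) (M u)

/-- The generalized q-binomial coefficient `[u; v] = 𝖬_v(⟨u⟩)/𝖬_v(⟨v⟩)`. -/
def qbin (q t : ℂ) (M : (Fin n → ℕ) → MvPolynomial (Fin n) ℂ) (u v : Fin n → ℕ) : ℂ :=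
  eval (spec q t u) (MM q t M v) / eval (spec q t v) (MM q t M v)

/-- `⟨0⟩/a = (t^{n−1}/a, …, t/a, 1/a)`. -/
def spec0div (q t a : ℂ) : Fin n → ℂ := fun i => spec q t (fun _ => 0) i / a

/-- `cc` is the family of connection coefficients `c_{uv}(a,b)`:
`cc u v = 0` unless `|v| ≤ |u|`, and `𝖬_u(a·x) = Σ_v cc u v · 𝖬_v(b·x)`. -/
def IsConnection (q t : ℂ) (M : (Fin n → ℕ) → MvPolynomial (Fin n) ℂ) (a b : ℂ)
    (cc : (Fin n → ℕ) → (Fin n → ℕ) → ℂ) : Prop :=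
  (∀ u v, wt u < wt v → cc u v = 0) ∧
  ∀ u, aeval (fun i => C a * X i) (MM q t M u) =
    ∑ᶠ v, cc u v • aeval (fun i => C b * X i) (MM q t M v)

/-- `⟦u, v⟧(a, b) = (𝖤_v(⟨0⟩/a)/𝖤_u(⟨0⟩/b)) · c_{uv}(a, b)`. -/
def skew (q t : ℂ) (M : (Fin n → ℕ) → MvPolynomial (Fin n) ℂ) (a b : ℂ)
    (cc : (Fin n → ℕ) → (Fin n → ℕ) → ℂ) (u v : Fin n → ℕ) : ℂ :=
  eval (spec0div q t a) (EE q t M v) / eval (spec0div q t b) (EE q t M u) * cc u v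

/-- `(z; q)_∞ = ∏_{m ≥ 0} (1 − z q^m)`. -/
noncomputable def qpochInf (z q : ℂ) : ℂ := ∏' m : ℕ, (1 - z * q ^ m)

/-! ### Combinatorics of compositions -/

/-- The order on the parts of `u` whose rank function is `lp u`. -/
def Precedes {n : ℕ} (u : Fin n → ℕ) (m k : Fin n) : Prop := u k < u m ∨ (u m = u k ∧ m < k)

instance {n : ℕ} (u : Fin n → ℕ) (m k : Fin n) : Decidable (Precedes u m k) := by
  unfold Precedes; infer_instance

lemma lp_eq_card {n : ℕ} (u : Fin n → ℕ) (k : Fin n) :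
    lp u k = (Finset.univ.filter fun m => Precedes u m k).card := by
  rw [lp, ← Finset.card_union_of_disjoint]
  · congr 1
    ext m
    simp only [Finset.mem_union, Finset.mem_filter, Finset.mem_univ, true_and]
    unfold Precedes
    rcases lt_trichotomy m k with h | h | h
    · simp only [h, h.not_gt, false_and, true_and, false_or, and_true]
      rw [le_iff_lt_or_eq, eq_comm]
    · subst h; simp
    · simp only [h, h.not_gt, false_and, true_and, and_false, or_false]
  · rw [Finset.disjoint_filter]
    rintro m - ⟨h, -⟩ ⟨h', -⟩
    exact absurd h h'.not_gt

lemma lp_lt {n : ℕ} (u : Fin n → ℕ) (k : Fin n) : lp u k < n := by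
  rw [lp_eq_card]
  calc _ < (Finset.univ : Finset (Fin n)).card := by
        refine Finset.card_lt_card ((Finset.filter_ssubset).2 ⟨k, Finset.mem_univ _, ?_⟩)
        simp [Precedes]
    _ = n := by simp

lemma lp_eq_of_precedes_iff {n : ℕ} {u w : Fin n → ℕ} (σ : Equiv.Perm (Fin n))
    (k : Fin n) (h : ∀ m, Precedes w m k ↔ Precedes u (σ m) (σ k)) : lp w k = lp u (σ k) := by
  rw [lp_eq_card, lp_eq_card]
  refine Finset.card_equiv σ fun m => ?_
  simp [h]

/-- The composition `(u₂, …, u_n, u₁ + 1)`. -/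
def rot {N : ℕ} (u : Fin (N + 1) → ℕ) : Fin (N + 1) → ℕ :=
  Fin.snoc (α := fun _ => ℕ) (fun i => u i.succ) (u 0 + 1)

@[simp] lemma rot_castSucc {N : ℕ} (u : Fin (N + 1) → ℕ) (i : Fin N) :
    rot u i.castSucc = u i.succ := by simp [rot]

@[simp] lemma rot_last {N : ℕ} (u : Fin (N + 1) → ℕ) : rot u (Fin.last N) = u 0 + 1 := by
  simp [rot]

/-- The adjacent transposition exchanging the positions `i` and `i + 1`. -/
def adj {N : ℕ} (i : Fin N) : Equiv.Perm (Fin (N + 1)) := Equiv.swap i.castSucc i.succ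

@[simp] lemma adj_castSucc {N : ℕ} (i : Fin N) : adj i i.castSucc = i.succ :=
  Equiv.swap_apply_left _ _

@[simp] lemma adj_succ {N : ℕ} (i : Fin N) : adj i i.succ = i.castSucc :=
  Equiv.swap_apply_right _ _

@[simp] lemma adj_adj {N : ℕ} (i : Fin N) (k : Fin (N + 1)) : adj i (adj i k) = k :=
  Equiv.swap_apply_self _ _ _

lemma adj_of_ne {N : ℕ} (i : Fin N) {k : Fin (N + 1)} (h : k ≠ i.castSucc) (h' : k ≠ i.succ) :
    adj i k = k := Equiv.swap_apply_of_ne_of_ne h h'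

lemma adj_val {N : ℕ} (i : Fin N) (j : Fin (N + 1)) : (adj i j : ℕ) =
    if (j : ℕ) = (i : ℕ) then (i : ℕ) + 1 else if (j : ℕ) = (i : ℕ) + 1 then (i : ℕ) else (j : ℕ) := by
  by_cases h1 : j = i.castSucc
  · simp [h1]
  by_cases h2 : j = i.succ
  · simp [h2]
  rw [adj_of_ne i h1 h2, if_neg (by simpa [Fin.ext_iff] using h1),
    if_neg (by simpa [Fin.ext_iff] using h2)]

lemma comp_adj_of_eq {N : ℕ} {α : Type*} {u : Fin (N + 1) → α} {i : Fin N}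
    (h : u i.castSucc = u i.succ) : u ∘ adj i = u := by
  funext k
  by_cases h1 : k = i.castSucc
  · subst h1; simp [h]
  by_cases h2 : k = i.succ
  · subst h2; simp [h]
  simp [adj_of_ne i h1 h2]

lemma comp_adj_comp_adj {N : ℕ} {α : Type*} (u : Fin (N + 1) → α) (i : Fin N) :
    (u ∘ adj i) ∘ adj i = u := by
  funext k; simp

lemma wt_comp {n : ℕ} (u : Fin n → ℕ) (σ : Equiv.Perm (Fin n)) : wt (u ∘ σ) = wt u :=
  Equiv.sum_comp σ u

lemma wt_rot {N : ℕ} (u : Fin (N + 1) → ℕ) : wt (rot u) = wt u + 1 := by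
  simp [wt, Fin.sum_univ_castSucc (f := rot u), Fin.sum_univ_succ (f := u)]; omega

lemma finRotate_castSucc {N : ℕ} (i : Fin N) : finRotate (N + 1) i.castSucc = i.succ := by
  rw [finRotate_apply, Fin.coeSucc_eq_succ]

lemma exists_eq_rot {N : ℕ} (u : Fin (N + 1) → ℕ) (h : u (Fin.last N) ≠ 0) :
    ∃ v, u = rot v := by
  refine ⟨Fin.cons (α := fun _ => ℕ) (u (Fin.last N) - 1) (fun i => u i.castSucc), ?_⟩
  funext k
  refine Fin.lastCases ?_ (fun i => ?_) k
  · simp; omega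
  · simp

lemma lp_rot {N : ℕ} (u : Fin (N + 1) → ℕ) (k : Fin (N + 1)) :
    lp (rot u) k = lp u (finRotate (N + 1) k) := by
  refine lp_eq_of_precedes_iff _ k fun m => ?_
  unfold Precedes
  refine Fin.lastCases ?_ (fun i => ?_) k <;> refine Fin.lastCases ?_ (fun j => ?_) m
  · simp
  · simp only [finRotate_last, finRotate_castSucc, rot_last, rot_castSucc, Fin.castSucc_lt_last,
      Fin.not_lt_zero, and_true, and_false, or_false]; omega
  · simp only [finRotate_last, finRotate_castSucc, rot_last, rot_castSucc, Fin.succ_pos,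
      (Fin.castSucc_lt_last _).not_gt, and_true, and_false, or_false]; omega
  · simp

lemma lp_comp_adj {N : ℕ} (u : Fin (N + 1) → ℕ) (i : Fin N) (h : u i.castSucc ≠ u i.succ)
    (k : Fin (N + 1)) : lp (u ∘ adj i) k = lp u (adj i k) := by
  refine lp_eq_of_precedes_iff _ k fun m => ?_
  unfold Precedes
  simp only [Function.comp]
  refine or_congr_right (and_congr_right fun hu => ?_)
  have hmk : ¬((m : ℕ) = i ∧ (k : ℕ) = i + 1) := by
    rintro ⟨h1, h2⟩
    obtain rfl : m = i.castSucc := Fin.ext h1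
    obtain rfl : k = i.succ := Fin.ext h2
    simp at hu; exact h hu.symm
  have hkm : ¬((k : ℕ) = i ∧ (m : ℕ) = i + 1) := by
    rintro ⟨h1, h2⟩
    obtain rfl : k = i.castSucc := Fin.ext h1
    obtain rfl : m = i.succ := Fin.ext h2
    simp at hu; exact h hu
  rw [Fin.lt_def, Fin.lt_def, adj_val, adj_val]
  split_ifs <;> omega

lemma lp_succ_of_eq {N : ℕ} (u : Fin (N + 1) → ℕ) (i : Fin N) (h : u i.castSucc = u i.succ) :
    lp u i.succ = lp u i.castSucc + 1 := by
  have : (Finset.univ.filter fun m => Precedes u m i.succ) =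
      insert i.castSucc (Finset.univ.filter fun m => Precedes u m i.castSucc) := by
    ext m
    simp only [Finset.mem_filter, Finset.mem_univ, true_and, Finset.mem_insert]
    simp only [Precedes, ← h]
    by_cases hm : m = i.castSucc
    · simp [hm]
    · have : (m : ℕ) ≠ i := fun h => hm (Fin.ext h)
      simp only [hm, false_or, Fin.lt_def, Fin.val_succ, Fin.val_castSucc]
      refine or_congr_right (and_congr_right fun _ => ?_)
      omega
  rw [lp_eq_card, lp_eq_card, this, Finset.card_insert_of_notMem]
  simp only [Finset.mem_filter]
  simp [Precedes]

/-- The spectral containment of compositions: after matching parts of equal rank, each part of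
`v` is at most the corresponding part of `w`. -/
def Contained {n : ℕ} (v w : Fin n → ℕ) : Prop :=
  ∃ π : Equiv.Perm (Fin n), ∀ i, lp w (π i) = lp v i ∧ v i ≤ w (π i)

lemma Contained.refl {n : ℕ} (v : Fin n → ℕ) : Contained v v := ⟨1, fun _ => ⟨rfl, le_rfl⟩⟩

lemma Contained.comp_adj {N : ℕ} {v w : Fin (N + 1) → ℕ} (i : Fin N) (h : Contained v w) :
    Contained v (w ∘ adj i) := by
  by_cases hw : w i.castSucc = w i.succ
  · rwa [comp_adj_of_eq hw]
  obtain ⟨π, hπ⟩ := h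
  refine ⟨π.trans (adj i), fun k => ?_⟩
  rw [lp_comp_adj _ _ hw]
  simpa using hπ k

lemma Contained.rot {N : ℕ} {v w : Fin (N + 1) → ℕ} (h : Contained v w) :
    Contained v (rot w) := by
  obtain ⟨π, hπ⟩ := h
  refine ⟨π.trans (finRotate (N + 1)).symm, fun k => ?_⟩
  rw [lp_rot]
  refine ⟨by simpa using (hπ k).1, (hπ k).2.trans ?_⟩
  obtain ⟨j, hj⟩ : ∃ j, π k = finRotate (N + 1) j := ⟨_, ((finRotate (N + 1)).apply_symm_apply _).symm⟩
  simp only [Equiv.trans_apply, hj, Equiv.symm_apply_apply]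
  refine Fin.lastCases ?_ (fun i => ?_) j
  · simp
  · simp

/-! ### Spectral vectors -/

/-- The parameters `q, t` are nonzero and multiplicatively independent. -/
structure IsGeneric (q t : ℂ) : Prop where
  q_ne : q ≠ 0
  t_ne : t ≠ 0
  ne_one : ∀ i j : ℤ, ¬(i = 0 ∧ j = 0) → q ^ i * t ^ j ≠ 1

namespace IsGeneric

variable {q t : ℂ} (hg : IsGeneric q t)
include hg

lemma pow_injective {a b c d : ℕ} (h : q ^ a * t ^ b = q ^ c * t ^ d) : a = c ∧ b = d := by
  have hq := hg.q_ne
  have ht := hg.t_ne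
  by_contra hne
  refine hg.ne_one (a - c) (b - d) (by omega) ?_
  rw [zpow_sub₀ hq, zpow_sub₀ ht, div_mul_div_comm, div_eq_one_iff_eq (by positivity)]
  exact_mod_cast h

lemma spec_ne_zero {n : ℕ} (u : Fin n → ℕ) (i : Fin n) : spec q t u i ≠ 0 :=
  mul_ne_zero (pow_ne_zero _ hg.q_ne) (pow_ne_zero _ hg.t_ne)

lemma spec_injective {n : ℕ} : Function.Injective (spec (n := n) q t) := by
  intro u v h
  funext i
  exact (hg.pow_injective (congrFun h i)).1

lemma spec_ne {N : ℕ} (u : Fin (N + 1) → ℕ) (i : Fin N) :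
    spec q t u i.castSucc ≠ spec q t u i.succ := by
  intro h
  obtain ⟨h1, h2⟩ := hg.pow_injective h
  have := lp_succ_of_eq u i h1
  have := lp_lt u i.succ
  omega

end IsGeneric

lemma spec_rot_castSucc {N : ℕ} (q t : ℂ) (u : Fin (N + 1) → ℕ) (i : Fin N) :
    spec q t (rot u) i.castSucc = spec q t u i.succ := by
  simp [spec, lp_rot]

lemma spec_rot_last {N : ℕ} (q t : ℂ) (u : Fin (N + 1) → ℕ) :
    spec q t (rot u) (Fin.last N) = q * spec q t u 0 := by
  simp [spec, lp_rot]; ring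

lemma spec_comp_adj {N : ℕ} (q t : ℂ) (u : Fin (N + 1) → ℕ) (i : Fin N)
    (h : u i.castSucc ≠ u i.succ) : spec q t (u ∘ adj i) = spec q t u ∘ adj i := by
  funext k
  simp [spec, lp_comp_adj u i h]

lemma spec_castSucc_of_eq {N : ℕ} (q t : ℂ) (u : Fin (N + 1) → ℕ) (i : Fin N)
    (h : u i.castSucc = u i.succ) : spec q t u i.castSucc = t * spec q t u i.succ := by
  have h1 := lp_succ_of_eq u i h
  have h2 := lp_lt u i.succ
  rw [spec, spec, h, show N + 1 - 1 - lp u i.castSucc = (N + 1 - 1 - lp u i.succ) + 1 by omega]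
  ring

lemma spec_last_of_eq_zero {N : ℕ} (q t : ℂ) (u : Fin (N + 1) → ℕ) (h : u (Fin.last N) = 0) :
    spec q t u (Fin.last N) = 1 := by
  have : lp u (Fin.last N) = N := by
    rw [lp_eq_card]
    have : (Finset.univ.filter fun m => Precedes u m (Fin.last N)) =
        Finset.univ.erase (Fin.last N) := by
      ext m
      simp only [Finset.mem_filter, Finset.mem_univ, true_and, Finset.mem_erase, and_true]
      simp only [Precedes, h, Fin.lt_last_iff_ne_last]
      by_cases hm : m = Fin.last N
      · simp [hm, h]
      · simp [hm]; omega
    rw [this]; simp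
  simp [spec, h, this]

lemma spec_snoc_zero_castSucc {N : ℕ} (q t : ℂ) (u : Fin N → ℕ) (i : Fin N) :
    spec q t (Fin.snoc (α := fun _ => ℕ) u 0 : Fin (N + 1) → ℕ) i.castSucc =
      t * spec q t u i := by
  have : lp (Fin.snoc (α := fun _ => ℕ) u 0 : Fin (N + 1) → ℕ) i.castSucc = lp u i := by
    rw [lp_eq_card, lp_eq_card]
    symm
    refine Finset.card_bij (fun m _ => m.castSucc) ?_ ?_ ?_
    · intro m hm
      simp only [Finset.mem_filter] at hm ⊢
      simpa [Precedes] using hm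
    · intro a _ b _ h; simpa using h
    · intro m hm
      simp only [Finset.mem_filter] at hm
      refine Fin.lastCases (fun hm => ?_) (fun j hm => ?_) m hm
      · simp [Precedes, (Fin.castSucc_lt_last i).not_gt] at hm
      · refine ⟨j, ?_, rfl⟩
        simp only [Finset.mem_filter]
        simpa [Precedes] using hm
  have h2 := lp_lt u i
  rw [spec, spec, this, show N + 1 - 1 - lp u i = (N - 1 - lp u i) + 1 by omega]
  simp; ring

/-! ### Substitutions and degrees -/

lemma dvd_sub_algHom {σ : Type*} (φ : MvPolynomial σ ℂ →ₐ[ℂ] MvPolynomial σ ℂ)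
    {d : MvPolynomial σ ℂ} (h : ∀ k, d ∣ X k - φ (X k)) (p : MvPolynomial σ ℂ) :
    d ∣ p - φ p := by
  induction p using MvPolynomial.induction_on with
  | C a => simp
  | add p r hp hr =>
    rw [map_add, add_sub_add_comm]
    exact dvd_add hp hr
  | mul_X p k hp =>
    have : p * X k - φ (p * X k) = (p - φ p) * X k + φ p * (X k - φ (X k)) := by
      rw [map_mul]; ring
    rw [this]
    exact dvd_add (hp.mul_right _) ((h k).mul_left _)

lemma totalDegree_aeval_le {σ τ : Type*} (f : σ → MvPolynomial τ ℂ)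
    (hf : ∀ k, (f k).totalDegree ≤ 1) (p : MvPolynomial σ ℂ) :
    (aeval f p).totalDegree ≤ p.totalDegree := by
  rw [aeval_def, eval₂_eq]
  refine totalDegree_finsetSum_le fun d hd => ?_
  refine (totalDegree_mul _ _).trans ?_
  rw [algebraMap_eq, totalDegree_C, zero_add]
  refine (totalDegree_finsetProd _ _).trans ((Finset.sum_le_sum fun i _ => ?_).trans
    (le_totalDegree hd))
  calc _ ≤ d i * (f i).totalDegree := totalDegree_pow _ _
    _ ≤ d i := by simpa using Nat.mul_le_mul_left (d i) (hf i)

lemma one_le_totalDegree {σ : Type*} {p : MvPolynomial σ ℂ} {i : σ}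
    (h : coeff (Finsupp.single i 1) p ≠ 0) : 1 ≤ p.totalDegree := by
  simpa using le_totalDegree (mem_support_iff.2 h)

/-- Dividing by a polynomial with a linear term lowers the degree. -/
lemma totalDegree_lt_of_mul_eq {σ : Type*} {d g f : MvPolynomial σ ℂ} {i : σ}
    (hd : coeff (Finsupp.single i 1) d ≠ 0) (hf : f = d * g) (hg : g ≠ 0) :
    g.totalDegree + 1 ≤ f.totalDegree := by
  have hd0 : d ≠ 0 := by rintro rfl; simp at hd
  rw [hf, totalDegree_mul_of_isDomain hd0 hg]
  have := one_le_totalDegree hd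
  omega

/-- The point `(x₂, …, x_n, q x₁)`. -/
def rotPt {N : ℕ} (q : ℂ) (x : Fin (N + 1) → ℂ) : Fin (N + 1) → ℂ :=
  Fin.snoc (α := fun _ => ℂ) (fun i => x i.succ) (q * x 0)

/-- The point `(x_n / q, x₁, …, x_{n-1})`. -/
def unrotPt {N : ℕ} (q : ℂ) (x : Fin (N + 1) → ℂ) : Fin (N + 1) → ℂ :=
  Fin.cons (α := fun _ => ℂ) (q⁻¹ * x (Fin.last N)) (fun i => x i.castSucc)

lemma rotPt_unrotPt {N : ℕ} {q : ℂ} (hq : q ≠ 0) (x : Fin (N + 1) → ℂ) :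
    rotPt q (unrotPt q x) = x := by
  funext k
  refine Fin.lastCases ?_ (fun i => ?_) k <;> simp [rotPt, unrotPt, hq]

lemma unrotPt_rotPt {N : ℕ} {q : ℂ} (hq : q ≠ 0) (x : Fin (N + 1) → ℂ) :
    unrotPt q (rotPt q x) = x := by
  funext k
  refine Fin.cases ?_ (fun i => ?_) k <;> simp [rotPt, unrotPt, hq]

lemma spec_rot {N : ℕ} (q t : ℂ) (u : Fin (N + 1) → ℕ) :
    spec q t (rot u) = rotPt q (spec q t u) := by
  funext k
  refine Fin.lastCases ?_ (fun i => ?_) k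
  · simp [rotPt, spec_rot_last]
  · simp [rotPt, spec_rot_castSucc]

/-- Substitution of `(x₂, …, x_n, q x₁)`. -/
def rotHom {N : ℕ} (q : ℂ) : MvPolynomial (Fin (N + 1)) ℂ →ₐ[ℂ] MvPolynomial (Fin (N + 1)) ℂ :=
  aeval (Fin.snoc (α := fun _ => MvPolynomial (Fin (N + 1)) ℂ) (fun i => X i.succ) (C q * X 0))

/-- Substitution of `(x_n / q, x₁, …, x_{n-1})`. -/
def unrotHom {N : ℕ} (q : ℂ) : MvPolynomial (Fin (N + 1)) ℂ →ₐ[ℂ] MvPolynomial (Fin (N + 1)) ℂ :=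
  aeval (Fin.cons (α := fun _ => MvPolynomial (Fin (N + 1)) ℂ) (C q⁻¹ * X (Fin.last N))
    (fun i => X i.castSucc))

lemma eval_aeval {σ τ : Type*} (f : σ → MvPolynomial τ ℂ) (x : τ → ℂ) (p : MvPolynomial σ ℂ) :
    eval x (aeval f p) = eval (fun k => eval x (f k)) p := by
  induction p using MvPolynomial.induction_on with
  | C a => simp
  | add p r hp hr => rw [map_add, map_add, hp, hr, map_add]
  | mul_X p k hp => rw [map_mul, map_mul, hp, aeval_X, map_mul, eval_X]

lemma eval_rotHom {N : ℕ} (q : ℂ) (x : Fin (N + 1) → ℂ) (p : MvPolynomial (Fin (N + 1)) ℂ) :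
    eval x (rotHom q p) = eval (rotPt q x) p := by
  rw [rotHom, eval_aeval]
  congr 2
  funext k
  refine Fin.lastCases ?_ (fun i => ?_) k <;> simp [rotPt]

lemma eval_unrotHom {N : ℕ} (q : ℂ) (x : Fin (N + 1) → ℂ) (p : MvPolynomial (Fin (N + 1)) ℂ) :
    eval x (unrotHom q p) = eval (unrotPt q x) p := by
  rw [unrotHom, eval_aeval]
  congr 2
  funext k
  refine Fin.cases ?_ (fun i => ?_) k <;> simp [unrotPt]

lemma totalDegree_C_mul_X_le {σ : Type*} (c : ℂ) (i : σ) :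
    (C c * X i : MvPolynomial σ ℂ).totalDegree ≤ 1 := by
  refine (totalDegree_mul _ _).trans ?_
  simp

lemma totalDegree_rotHom_le {N : ℕ} (q : ℂ) (p : MvPolynomial (Fin (N + 1)) ℂ) :
    (rotHom q p).totalDegree ≤ p.totalDegree := by
  refine totalDegree_aeval_le _ (fun k => ?_) p
  refine Fin.lastCases ?_ (fun i => ?_) k
  · simpa using totalDegree_C_mul_X_le _ _
  · simp

lemma totalDegree_unrotHom_le {N : ℕ} (q : ℂ) (p : MvPolynomial (Fin (N + 1)) ℂ) :
    (unrotHom q p).totalDegree ≤ p.totalDegree := by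
  refine totalDegree_aeval_le _ (fun k => ?_) p
  refine Fin.cases ?_ (fun i => ?_) k
  · simpa using totalDegree_C_mul_X_le _ _
  · simp

/-! ### Interpolation at the spectral vectors -/

/-- A polynomial vanishing where `x_n = c` is divisible by `x_n - c`. -/
lemma X_last_sub_C_dvd {N : ℕ} {c : ℂ} {f : MvPolynomial (Fin (N + 1)) ℂ}
    (h : ∀ x : Fin N → ℂ, eval (Fin.snoc (α := fun _ => ℂ) x c) f = 0) :
    X (Fin.last N) - C c ∣ f := by
  let φ : MvPolynomial (Fin (N + 1)) ℂ →ₐ[ℂ] MvPolynomial (Fin (N + 1)) ℂ :=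
    aeval (Fin.snoc (α := fun _ => MvPolynomial (Fin (N + 1)) ℂ) (fun i => X i.castSucc) (C c))
  have h0 : φ f = 0 := by
    refine MvPolynomial.funext fun x => ?_
    rw [map_zero, ← h (fun i => x i.castSucc), eval_aeval]
    congr 2
    funext k
    refine Fin.lastCases ?_ (fun i => ?_) k <;> simp
  have := dvd_sub_algHom φ (d := X (Fin.last N) - C c) (fun k => ?_) f
  · rwa [h0, sub_zero] at this
  · refine Fin.lastCases ?_ (fun i => ?_) k <;> simp [φ]

lemma coeff_single_X_sub_C {σ : Type*} (i : σ) (c : ℂ) :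
    coeff (Finsupp.single i 1) (X i - C c : MvPolynomial σ ℂ) ≠ 0 := by
  classical
  have : (0 : σ →₀ ℕ) ≠ Finsupp.single i 1 := by
    intro h; simpa using congrArg (· i) h
  simp [coeff_sub, coeff_C, this]

namespace IsGeneric

variable {q t : ℂ} (hg : IsGeneric q t)
include hg

lemma eq_zero_of_eval_smul_spec : ∀ (n : ℕ) {c : ℂ}, c ≠ 0 → ∀ (m : ℕ)
    {f : MvPolynomial (Fin n) ℂ}, f.totalDegree ≤ m →
    (∀ w, wt w ≤ m → eval (fun i => c * spec q t w i) f = 0) → f = 0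
  | 0, c, _, m, f, _, hv => by
    have h := hv (fun i => i.elim0) (by simp [wt])
    rw [eq_C_of_isEmpty f] at h ⊢
    simpa using h
  | N + 1, c, hc, m, f, hf, hv => by
    induction m using Nat.strong_induction_on generalizing f with
    | _ m ih =>
    by_contra hf0
    obtain ⟨g, rfl⟩ : X (Fin.last N) - C c ∣ f := by
      refine X_last_sub_C_dvd fun x => ?_
      let ψ : MvPolynomial (Fin (N + 1)) ℂ →ₐ[ℂ] MvPolynomial (Fin N) ℂ :=
        aeval (Fin.snoc (α := fun _ => MvPolynomial (Fin N) ℂ) X (C c))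
      have hψ (x : Fin N → ℂ) : eval x (ψ f) = eval (Fin.snoc (α := fun _ => ℂ) x c) f := by
        rw [eval_aeval]
        congr 2
        funext k
        refine Fin.lastCases ?_ (fun i => ?_) k <;> simp
      have h0 : ψ f = 0 := by
        refine eq_zero_of_eval_smul_spec N (mul_ne_zero hc hg.t_ne) m
          ((totalDegree_aeval_le _ (fun k => ?_) f).trans hf) fun w hw => ?_
        · refine Fin.lastCases ?_ (fun i => ?_) k <;> simp
        · rw [hψ, ← hv (Fin.snoc (α := fun _ => ℕ) w 0)
            (by simpa [wt, Fin.sum_univ_castSucc] using hw)]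
          congr 2
          funext k
          refine Fin.lastCases ?_ (fun i => ?_) k
          · rw [spec_last_of_eq_zero] <;> simp
          · rw [spec_snoc_zero_castSucc]; simp; ring
      rw [← hψ, h0, map_zero]
    have hg0 : g ≠ 0 := by rintro rfl; simp at hf0
    have hdeg := totalDegree_lt_of_mul_eq (coeff_single_X_sub_C (Fin.last N) c) rfl hg0
    refine hg0 ?_
    have hzero : rotHom q g = 0 := by
      refine ih (m - 1) (by omega) (f := rotHom q g) ((totalDegree_rotHom_le q g).trans (by omega)) fun w hw => ?_
      have h1 := hv (rot w) (by rw [wt_rot]; omega)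
      have h2 : (fun i => c * spec q t (rot w) i) = rotPt q (fun i => c * spec q t w i) := by
        funext k
        rw [spec_rot]
        refine Fin.lastCases ?_ (fun i => ?_) k <;> simp [rotPt]
        ring
      rw [map_mul, mul_eq_zero, h2] at h1
      rw [eval_rotHom]
      refine h1.resolve_left fun h3 => ?_
      have h4 : q * spec q t w 0 = 1 := by
        refine mul_left_cancel₀ hc ?_
        simp [rotPt, sub_eq_zero] at h3
        linear_combination h3
      rw [spec, ← mul_assoc, ← pow_succ'] at h4
      refine hg.ne_one (w 0 + 1 : ℕ) (N + 1 - 1 - lp w 0 : ℕ) (by omega) ?_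
      exact_mod_cast h4
    refine MvPolynomial.funext fun x => ?_
    rw [← rotPt_unrotPt hg.q_ne x, ← eval_rotHom, hzero, map_zero, map_zero]

lemma eq_zero_of_eval_spec {n m : ℕ} {f : MvPolynomial (Fin n) ℂ} (hf : f.totalDegree ≤ m)
    (hv : ∀ w, wt w ≤ m → eval (spec q t w) f = 0) : f = 0 :=
  hg.eq_zero_of_eval_smul_spec n one_ne_zero m hf fun w hw => by simpa using hv w hw

end IsGeneric

section Interpolation

variable {q t : ℂ} (hg : IsGeneric q t) {n : ℕ}
include hg

lemma eval_spec_self_ne_zero {M : (Fin n → ℕ) → MvPolynomial (Fin n) ℂ}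
    (hM : IsInterpFamily q t M) (u : Fin n → ℕ) : eval (spec q t u) (M u) ≠ 0 := by
  intro h
  have h0 : M u = 0 := by
    refine hg.eq_zero_of_eval_spec (hM u).1 fun w hw => ?_
    by_cases hwu : w = u
    · rwa [hwu]
    · exact (hM u).2.2 w hw hwu
  have := (hM u).2.1
  rw [h0, coeff_zero] at this
  exact inv_ne_zero (pow_ne_zero _ hg.q_ne) this.symm

/-- A polynomial of degree at most `d` is determined by its values at the `⟨w⟩` of weight at
most `d`. -/
lemma eq_of_eval_spec {d : ℕ} {f g : MvPolynomial (Fin n) ℂ} (hf : f.totalDegree ≤ d)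
    (hg' : g.totalDegree ≤ d)
    (h : ∀ w, wt w ≤ d → eval (spec q t w) f = eval (spec q t w) g) : f = g := by
  rw [← sub_eq_zero]
  refine hg.eq_zero_of_eval_spec (m := d) ((totalDegree_sub _ _).trans (max_le hf hg')) ?_
  intro w hw
  rw [map_sub, h w hw, sub_self]

end Interpolation

/-! ### Demazure–Lusztig operators -/

section Operators

variable {N : ℕ}

lemma X_sub_X_dvd (i : Fin N) (p : MvPolynomial (Fin (N + 1)) ℂ) :
    (X i.castSucc - X i.succ : MvPolynomial (Fin (N + 1)) ℂ) ∣ rename (adj i) p - p := by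
  have := dvd_sub_algHom (rename (adj i)) (d := (X i.castSucc - X i.succ :
    MvPolynomial (Fin (N + 1)) ℂ)) (fun k => ?_) p
  · rwa [← dvd_neg, neg_sub]
  · rw [rename_X]
    by_cases h1 : k = i.castSucc
    · subst h1; simp
    by_cases h2 : k = i.succ
    · subst h2; rw [adj_succ, ← dvd_neg, neg_sub]
    · simp [adj_of_ne i h1 h2]

lemma coeff_single_X_sub_X (i : Fin N) : coeff (Finsupp.single i.castSucc 1)
    (X i.castSucc - X i.succ : MvPolynomial (Fin (N + 1)) ℂ) ≠ 0 := by
  classical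
  simp [coeff_X, Finsupp.single_left_inj, (Fin.castSucc_lt_succ (i := i)).ne']

lemma X_sub_X_ne_zero (i : Fin N) : (X i.castSucc - X i.succ : MvPolynomial (Fin (N + 1)) ℂ) ≠ 0 := by
  intro h
  exact coeff_single_X_sub_X i (by rw [h, coeff_zero])

lemma ext_of_ne (i : Fin N) {p r : MvPolynomial (Fin (N + 1)) ℂ}
    (h : ∀ x : Fin (N + 1) → ℂ, x i.castSucc ≠ x i.succ → eval x p = eval x r) : p = r := by
  refine mul_left_cancel₀ (X_sub_X_ne_zero i) (MvPolynomial.funext fun x => ?_)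
  by_cases hx : x i.castSucc = x i.succ
  · simp [hx]
  · simp [h x hx]

/-- The divided difference `(s_i p - p) / (x_i - x_{i+1})`. -/
def ddiff (i : Fin N) : Module.End ℂ (MvPolynomial (Fin (N + 1)) ℂ) where
  toFun p := (X_sub_X_dvd i p).choose
  map_add' p r := by
    refine mul_left_cancel₀ (X_sub_X_ne_zero i) ?_
    rw [mul_add, ← (X_sub_X_dvd i p).choose_spec, ← (X_sub_X_dvd i r).choose_spec,
      ← (X_sub_X_dvd i (p + r)).choose_spec, map_add]
    ring
  map_smul' c p := by
    refine mul_left_cancel₀ (X_sub_X_ne_zero i) ?_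
    rw [← (X_sub_X_dvd i (c • p)).choose_spec, RingHom.id_apply, mul_smul_comm,
      ← (X_sub_X_dvd i p).choose_spec, map_smul, smul_sub]

lemma X_sub_X_mul_ddiff (i : Fin N) (p : MvPolynomial (Fin (N + 1)) ℂ) :
    (X i.castSucc - X i.succ) * ddiff i p = rename (adj i) p - p :=
  (X_sub_X_dvd i p).choose_spec.symm

lemma totalDegree_X_mul_ddiff_le (i : Fin N) (k : Fin (N + 1))
    (p : MvPolynomial (Fin (N + 1)) ℂ) :
    (X k * ddiff i p).totalDegree ≤ p.totalDegree := by
  by_cases h : ddiff i p = 0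
  · simp [h]
  have h1 := totalDegree_lt_of_mul_eq (coeff_single_X_sub_X i) (X_sub_X_mul_ddiff i p).symm h
  have h2 := totalDegree_mul (X k) (ddiff i p)
  have h3 := totalDegree_sub (rename (adj i) p) p
  have h4 := totalDegree_rename_le (adj i) p
  rw [totalDegree_X] at h2
  rw [max_eq_right h4] at h3
  omega

lemma eval_ddiff (i : Fin N) {x : Fin (N + 1) → ℂ} (hx : x i.castSucc ≠ x i.succ)
    (p : MvPolynomial (Fin (N + 1)) ℂ) :
    eval x (ddiff i p) = (eval (x ∘ adj i) p - eval x p) / (x i.castSucc - x i.succ) := by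
  rw [eq_div_iff (sub_ne_zero.2 hx), mul_comm, ← eval_rename, ← map_sub, ← X_sub_X_mul_ddiff]
  simp

/-- The Demazure–Lusztig operator `T_i`. -/
def dl (t : ℂ) (i : Fin N) : Module.End ℂ (MvPolynomial (Fin (N + 1)) ℂ) :=
  (rename (adj i)).toLinearMap + (1 - t) • LinearMap.mulLeft ℂ (X i.succ) * ddiff i

/-- The inverse of the Demazure–Lusztig operator `T_i`. -/
def dlInv (t : ℂ) (i : Fin N) : Module.End ℂ (MvPolynomial (Fin (N + 1)) ℂ) :=
  (rename (adj i)).toLinearMap + (t⁻¹ - 1) • LinearMap.mulLeft ℂ (X i.castSucc) * ddiff i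

lemma dl_apply (t : ℂ) (i : Fin N) (p : MvPolynomial (Fin (N + 1)) ℂ) :
    dl t i p = rename (adj i) p + (1 - t) • (X i.succ * ddiff i p) := rfl

lemma dlInv_apply (t : ℂ) (i : Fin N) (p : MvPolynomial (Fin (N + 1)) ℂ) :
    dlInv t i p = rename (adj i) p + (t⁻¹ - 1) • (X i.castSucc * ddiff i p) := rfl

lemma totalDegree_dl_le (t : ℂ) (i : Fin N) (p : MvPolynomial (Fin (N + 1)) ℂ) :
    (dl t i p).totalDegree ≤ p.totalDegree :=
  (totalDegree_add _ _).trans (max_le (totalDegree_rename_le _ _)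
    ((totalDegree_smul_le _ _).trans (totalDegree_X_mul_ddiff_le _ _ _)))

/-- Diagonal coefficient of `T_i` at the point `x`. -/
def dlA (t : ℂ) (i : Fin N) (x : Fin (N + 1) → ℂ) : ℂ :=
  (t - 1) * x i.succ / (x i.castSucc - x i.succ)

/-- Off-diagonal coefficient of `T_i` at the point `x`. -/
def dlB (t : ℂ) (i : Fin N) (x : Fin (N + 1) → ℂ) : ℂ :=
  (x i.castSucc - t * x i.succ) / (x i.castSucc - x i.succ)

lemma eval_dl (t : ℂ) (i : Fin N) {x : Fin (N + 1) → ℂ} (hx : x i.castSucc ≠ x i.succ)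
    (p : MvPolynomial (Fin (N + 1)) ℂ) :
    eval x (dl t i p) = dlA t i x * eval x p + dlB t i x * eval (x ∘ adj i) p := by
  have := sub_ne_zero.2 hx
  rw [dl_apply, map_add, eval_rename, smul_eval, map_mul, eval_X, eval_ddiff i hx, dlA, dlB]
  field_simp
  ring

lemma eval_dlInv {t : ℂ} (ht : t ≠ 0) (i : Fin N) {x : Fin (N + 1) → ℂ}
    (hx : x i.castSucc ≠ x i.succ) (p : MvPolynomial (Fin (N + 1)) ℂ) :
    eval x (dlInv t i p) =
      t⁻¹ * ((dlA t i x + t - 1) * eval x p + dlB t i x * eval (x ∘ adj i) p) := by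
  have := sub_ne_zero.2 hx
  rw [dlInv_apply, map_add, eval_rename, smul_eval, map_mul, eval_X, eval_ddiff i hx, dlA, dlB]
  field_simp
  ring

lemma eval_dlInv_of_eq_zero (t : ℂ) (i : Fin N) {x : Fin (N + 1) → ℂ} (hx : x i.castSucc = 0)
    (p : MvPolynomial (Fin (N + 1)) ℂ) : eval x (dlInv t i p) = eval (x ∘ adj i) p := by
  simp [dlInv_apply, eval_rename, smul_eval, hx]

lemma dlInv_mul_dl {t : ℂ} (ht : t ≠ 0) (i : Fin N) : dlInv t i * dl t i = 1 := by
  refine LinearMap.ext fun p => ext_of_ne i fun x hx => ?_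
  have h1 := sub_ne_zero.2 hx
  have h2 := sub_ne_zero.2 hx.symm
  have hx' : (x ∘ adj i) i.castSucc ≠ (x ∘ adj i) i.succ := by simpa using hx.symm
  rw [Module.End.mul_apply, eval_dlInv ht i hx, eval_dl t i hx, eval_dl t i hx',
    comp_adj_comp_adj, Module.End.one_apply, dlA, dlB, dlA, dlB]
  simp only [Function.comp, adj_castSucc, adj_succ]
  rw [← neg_sub (x i.castSucc)] 
  field_simp
  ring

/-- The operator `p ↦ (x_n - 1) p(x_n / q, x₁, …, x_{n-1})`. -/
def raise (q : ℂ) : Module.End ℂ (MvPolynomial (Fin (N + 1)) ℂ) :=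
  LinearMap.mulLeft ℂ (X (Fin.last N) - 1) * (unrotHom q).toLinearMap

lemma eval_raise (q : ℂ) (x : Fin (N + 1) → ℂ) (p : MvPolynomial (Fin (N + 1)) ℂ) :
    eval x (raise q p) = (x (Fin.last N) - 1) * eval (unrotPt q x) p := by
  rw [← eval_unrotHom]
  simp [raise]

lemma eval_raise_rot {q : ℂ} (hq : q ≠ 0) (t : ℂ) (u : Fin (N + 1) → ℕ)
    (p : MvPolynomial (Fin (N + 1)) ℂ) : eval (spec q t (rot u)) (raise q p) =
      (q * spec q t u 0 - 1) * eval (spec q t u) p := by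
  rw [eval_raise, spec_rot, unrotPt_rotPt hq]
  simp [rotPt]

lemma totalDegree_raise_le (q : ℂ) (p : MvPolynomial (Fin (N + 1)) ℂ) :
    (raise q p).totalDegree ≤ p.totalDegree + 1 := by
  refine (totalDegree_mul _ _).trans ?_
  have h1 := totalDegree_unrotHom_le q p
  have h2 := totalDegree_sub (X (Fin.last N)) (1 : MvPolynomial (Fin (N + 1)) ℂ)
  rw [totalDegree_X, totalDegree_one] at h2
  simp only [AlgHom.toLinearMap_apply]
  omega

lemma eval_raise_eq_zero_of_last_eq_zero (q t : ℂ) {u : Fin (N + 1) → ℕ}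
    (hu : u (Fin.last N) = 0) (p : MvPolynomial (Fin (N + 1)) ℂ) :
    eval (spec q t u) (raise q p) = 0 := by
  rw [eval_raise, spec_last_of_eq_zero q t u hu, sub_self, zero_mul]

end Operators

/-! ### Legs and normalizations -/

section Legs

variable {N : ℕ}

lemma leg_rot_castSucc (v : Fin (N + 1) → ℕ) (i : Fin N) (j : ℕ) :
    leg (rot v) i.castSucc j = leg v i.succ j := by
  simp only [leg, Finset.card_filter]
  conv_lhs => rw [Fin.sum_univ_castSucc, Fin.sum_univ_castSucc]
  conv_rhs => rw [Fin.sum_univ_succ, Fin.sum_univ_succ]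
  simp only [rot_castSucc, rot_last, Fin.castSucc_lt_castSucc_iff, Fin.castSucc_lt_last,
    Fin.succ_lt_succ_iff, Fin.not_lt_zero, Fin.succ_pos, (Fin.castSucc_lt_last _).not_gt,
    true_and, false_and, if_false, Order.lt_add_one_iff, Order.add_one_le_iff]
  ring

lemma leg_rot_last_succ (v : Fin (N + 1) → ℕ) (j : ℕ) :
    leg (rot v) (Fin.last N) (j + 1) = leg v 0 j := by
  simp only [leg, Finset.card_filter]
  rw [Fin.sum_univ_castSucc, Fin.sum_univ_castSucc, Fin.sum_univ_succ, Fin.sum_univ_succ]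
  simp only [rot_castSucc, rot_last, Fin.castSucc_lt_last,
    Fin.not_lt_zero, Fin.succ_pos, (Fin.castSucc_lt_last _).not_gt, lt_irrefl,
    true_and, false_and, if_false, Order.lt_add_one_iff, Order.add_one_le_iff]
  simp

lemma leg_rot_last_zero (v : Fin (N + 1) → ℕ) :
    leg (rot v) (Fin.last N) 0 = N + 1 - 1 - lp v 0 := by
  have : leg (rot v) (Fin.last N) 0 + lp v 0 = N := by
    simp only [leg, lp, Finset.card_filter]
    rw [Fin.sum_univ_castSucc, Fin.sum_univ_castSucc, Fin.sum_univ_succ, Fin.sum_univ_succ]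
    simp only [rot_castSucc, rot_last, Fin.castSucc_lt_last, zero_le,
      Fin.not_lt_zero, Fin.succ_pos, (Fin.castSucc_lt_last _).not_gt, lt_irrefl,
      true_and, false_and, if_false, Order.lt_add_one_iff, Finset.sum_const_zero, zero_add,
      add_zero, and_false]
    rw [← Finset.sum_add_distrib]
    calc _ = ∑ _i : Fin N, 1 := Finset.sum_congr rfl fun i _ => by
          by_cases h : v i.succ ≤ v 0
          · simp [h, h.not_gt]
          · simp [h, lt_of_not_ge h]
      _ = N := by simp
  omega

variable (i : Fin N) {u : Fin (N + 1) → ℕ}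

lemma lt_adj_iff {k : Fin (N + 1)} (h : k ≠ i.castSucc) (h' : k ≠ i.succ) (m : Fin (N + 1)) :
    k < adj i m ↔ k < m := by
  have h1 : (k : ℕ) ≠ i := fun e => h (Fin.ext e)
  have h2 : (k : ℕ) ≠ i + 1 := fun e => h' (Fin.ext e)
  by_cases hm : m = i.castSucc
  · subst hm; simp only [adj_castSucc, Fin.lt_def, Fin.val_succ, Fin.val_castSucc]; omega
  by_cases hm' : m = i.succ
  · subst hm'; simp only [adj_succ, Fin.lt_def, Fin.val_succ, Fin.val_castSucc]; omega
  rw [adj_of_ne i hm hm']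

lemma adj_lt_iff {k : Fin (N + 1)} (h : k ≠ i.castSucc) (h' : k ≠ i.succ) (m : Fin (N + 1)) :
    adj i m < k ↔ m < k := by
  have h1 : (k : ℕ) ≠ i := fun e => h (Fin.ext e)
  have h2 : (k : ℕ) ≠ i + 1 := fun e => h' (Fin.ext e)
  by_cases hm : m = i.castSucc
  · subst hm; simp only [adj_castSucc, Fin.lt_def, Fin.val_succ, Fin.val_castSucc]; omega
  by_cases hm' : m = i.succ
  · subst hm'; simp only [adj_succ, Fin.lt_def, Fin.val_succ, Fin.val_castSucc]; omega
  rw [adj_of_ne i hm hm']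

lemma leg_comp_adj_of_ne {k : Fin (N + 1)} (h : k ≠ i.castSucc) (h' : k ≠ i.succ) (j : ℕ) :
    leg (u ∘ adj i) k j = leg u k j := by
  rw [leg, leg]
  congr 1 <;> refine Finset.card_equiv (adj i) fun m => ?_ <;>
    simp only [Finset.mem_filter, Finset.mem_univ, true_and, Function.comp, adj_of_ne i h h',
      lt_adj_iff i h h', adj_lt_iff i h h']

lemma sum_congr_adj {f g : Fin (N + 1) → ℕ} (h1 : f i.castSucc = g i.castSucc)
    (h2 : f i.succ = g i.succ)
    (h3 : ∀ k, k ≠ i.castSucc → k ≠ i.succ → f k = g k) : ∑ k, f k = ∑ k, g k := by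
  refine Finset.sum_congr rfl fun k _ => ?_
  by_cases h : k = i.castSucc
  · rwa [h]
  by_cases h' : k = i.succ
  · rwa [h']
  exact h3 k h h'

variable (h0 : u i.castSucc = 0) (hpos : 0 < u i.succ)
include h0 hpos

lemma leg_succ_of_zero (j : ℕ) : leg u i.succ j =
    leg (u ∘ adj i) i.castSucc j + if j = 0 then 1 else 0 := by
  have hj : (if j = 0 then 1 else 0) = ∑ k : Fin (N + 1), if k = i.castSucc ∧ j = 0 then 1 else 0 := by
    by_cases h : j = 0 <;> simp [h]
  simp only [leg, Finset.card_filter]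
  rw [hj, ← Finset.sum_add_distrib, ← Finset.sum_add_distrib, ← Finset.sum_add_distrib]
  refine sum_congr_adj i ?_ ?_ fun k hk hk' => ?_
  · simp [h0, hpos, Fin.castSucc_lt_succ.not_gt]
  · simp [h0, Fin.castSucc_lt_succ.not_gt, Fin.castSucc_lt_succ.ne']
  · have e1 : i.succ < k ↔ i.castSucc < k := by
      have : (k : ℕ) ≠ i + 1 := fun e => hk' (Fin.ext e)
      simp only [Fin.lt_def, Fin.val_succ, Fin.val_castSucc]; omega
    have e2 : k < i.succ ↔ k < i.castSucc := by
      have : (k : ℕ) ≠ i := fun e => hk (Fin.ext e)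
      simp only [Fin.lt_def, Fin.val_succ, Fin.val_castSucc]; omega
    simp [hk, e1, e2, adj_of_ne i hk hk']

lemma lp_castSucc_of_zero : lp u i.castSucc =
    lp u i.succ + leg (u ∘ adj i) i.castSucc 0 + 1 := by
  have hj : 1 = ∑ k : Fin (N + 1), if k = i.succ then 1 else 0 := by simp
  simp only [lp, leg, Finset.card_filter]
  refine Eq.trans ?_ (congrArg (_ + ·) hj.symm)
  simp only [← Finset.sum_add_distrib]
  refine sum_congr_adj i ?_ ?_ fun k hk hk' => ?_
  · simp [h0, hpos.ne', Fin.castSucc_lt_succ.ne]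
  · simp [h0, hpos, Fin.castSucc_lt_succ.not_gt]
  · have e1 : i.succ < k ↔ i.castSucc < k := by
      have : (k : ℕ) ≠ i + 1 := fun e => hk' (Fin.ext e)
      simp only [Fin.lt_def, Fin.val_succ, Fin.val_castSucc]; omega
    have e2 : k < i.succ ↔ k < i.castSucc := by
      have : (k : ℕ) ≠ i := fun e => hk (Fin.ext e)
      simp only [Fin.lt_def, Fin.val_succ, Fin.val_castSucc]; omega
    simp only [h0, e1, e2, Function.comp, adj_of_ne i hk hk', adj_castSucc, hk', if_false]
    rcases lt_or_gt_of_ne hk with h | h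
    · simp only [h, h.not_gt, true_and, false_and, if_false, zero_le, if_true]
      split_ifs <;> omega
    · simp only [h, h.not_gt, true_and, false_and, if_false]
      split_ifs <;> omega

end Legs

/-- The factor relating `𝖬_u` to `M_u`. -/
def normc {n : ℕ} (q t : ℂ) (u : Fin n → ℕ) : ℂ := q ^ nstat' u * t ^ nstat u / cp q t u

lemma MM_eq {n : ℕ} (q t : ℂ) (M : (Fin n → ℕ) → MvPolynomial (Fin n) ℂ) (u : Fin n → ℕ) :
    MM q t M u = normc q t u • M u := by
  rw [smul_eq_C_mul]; rfl

lemma nstat'_rot {N : ℕ} (v : Fin (N + 1) → ℕ) : nstat' (rot v) = nstat' v + v 0 := by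
  simp only [nstat', Fin.sum_univ_castSucc (f := fun i => (rot v i).choose 2),
    Fin.sum_univ_succ (f := fun i => (v i).choose 2), rot_castSucc, rot_last]
  have : (v 0 + 1).choose 2 = v 0 + (v 0).choose 2 := by
    rw [Nat.choose_succ_succ' (v 0) 1, Nat.choose_one_right]
  omega

lemma nstat_rot {N : ℕ} (v : Fin (N + 1) → ℕ) :
    nstat (rot v) = nstat v + (N + 1 - 1 - lp v 0) := by
  rw [nstat, nstat, Fin.sum_univ_castSucc, Fin.sum_univ_succ, rot_last, Finset.sum_range_succ',
    leg_rot_last_zero]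
  simp only [leg_rot_castSucc, rot_castSucc, leg_rot_last_succ]
  ring

lemma cp_rot {N : ℕ} (q t : ℂ) (v : Fin (N + 1) → ℕ) :
    cp q t (rot v) = cp q t v * (1 - q * spec q t v 0) := by
  rw [cp, cp, Fin.prod_univ_castSucc, Fin.prod_univ_succ, rot_last, Finset.prod_range_succ',
    leg_rot_last_zero]
  simp only [leg_rot_castSucc, rot_castSucc, leg_rot_last_succ, spec, Nat.add_sub_add_right,
    Nat.sub_zero, pow_succ]
  ring

lemma nstat'_comp_adj {N : ℕ} (u : Fin (N + 1) → ℕ) (i : Fin N) :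
    nstat' (u ∘ adj i) = nstat' u := Equiv.sum_comp (adj i) fun k => (u k).choose 2

lemma nstat_comp_adj {N : ℕ} {u : Fin (N + 1) → ℕ} (i : Fin N) (h0 : u i.castSucc = 0)
    (hpos : 0 < u i.succ) : nstat u = nstat (u ∘ adj i) + 1 := by
  rw [nstat, nstat, ← Equiv.sum_comp (adj i) (fun k => ∑ j ∈ Finset.range ((u ∘ adj i) k), _)]
  have h1 : 1 = ∑ k : Fin (N + 1), if k = i.succ then 1 else 0 := by simp
  refine Eq.trans ?_ (congrArg (_ + ·) h1.symm)
  rw [← Finset.sum_add_distrib]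
  simp only [Function.comp_apply, adj_adj]
  refine sum_congr_adj i ?_ ?_ fun k hk hk' => ?_
  · simp [h0, Fin.castSucc_lt_succ.ne]
  · obtain ⟨p, hp⟩ := Nat.exists_eq_add_of_lt hpos
    rw [hp, Finset.sum_range_succ', Finset.sum_range_succ']
    simp [leg_succ_of_zero i h0 hpos]
    ring
  · simp [hk', adj_of_ne i hk hk', leg_comp_adj_of_ne i hk hk']

lemma cp_comp_adj {N : ℕ} (q t : ℂ) {u : Fin (N + 1) → ℕ} (i : Fin N) (h0 : u i.castSucc = 0)
    (hpos : 0 < u i.succ) :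
    cp q t u * (1 - q ^ u i.succ * t ^ leg (u ∘ adj i) i.castSucc 0) =
      cp q t (u ∘ adj i) * (1 - q ^ u i.succ * t ^ (leg (u ∘ adj i) i.castSucc 0 + 1)) := by
  rw [cp, cp, ← Equiv.prod_comp (adj i) (fun k => ∏ j ∈ Finset.range ((u ∘ adj i) k), _)]
  have h1 (c : ℂ) : c = ∏ k : Fin (N + 1), if k = i.succ then c else 1 := by simp
  rw [h1 (1 - q ^ u i.succ * t ^ leg (u ∘ adj i) i.castSucc 0),
    h1 (1 - q ^ u i.succ * t ^ (leg (u ∘ adj i) i.castSucc 0 + 1)),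
    ← Finset.prod_mul_distrib, ← Finset.prod_mul_distrib]
  refine Finset.prod_congr rfl fun k _ => ?_
  simp only [Function.comp_apply, adj_adj]
  by_cases hk : k = i.castSucc
  · simp [hk, h0, Fin.castSucc_lt_succ.ne]
  by_cases hk' : k = i.succ
  · subst hk'
    obtain ⟨p, hp⟩ := Nat.exists_eq_add_of_lt hpos
    rw [hp, Finset.prod_range_succ', Finset.prod_range_succ']
    simp only [leg_succ_of_zero i h0 hpos, adj_succ, if_true, Nat.add_eq_zero_iff, one_ne_zero,
      and_false, if_false, add_zero, Nat.sub_zero]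
    change _ = ((∏ j ∈ Finset.range (0 + p), (1 - q ^ (0 + p + 1 - (j + 1)) *
      t ^ leg (u ∘ adj i) i.castSucc (j + 1))) * (1 - q ^ (0 + p + 1) *
      t ^ leg (u ∘ adj i) i.castSucc 0)) * _
    ring
  · simp [hk', adj_of_ne i hk hk', leg_comp_adj_of_ne i hk hk']

namespace IsGeneric

variable {q t : ℂ} (hg : IsGeneric q t)
include hg

lemma one_sub_ne_zero {a b : ℕ} (ha : a ≠ 0) : 1 - q ^ a * t ^ b ≠ 0 := by
  rw [sub_ne_zero]
  intro h
  exact hg.ne_one a b (by omega) (by exact_mod_cast h.symm)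

lemma cp_ne_zero {n : ℕ} (u : Fin n → ℕ) : cp q t u ≠ 0 := by
  refine Finset.prod_ne_zero_iff.2 fun i _ => Finset.prod_ne_zero_iff.2 fun j hj => ?_
  exact hg.one_sub_ne_zero (by have := Finset.mem_range.1 hj; omega)

lemma one_sub_q_mul_spec_ne_zero {n : ℕ} (u : Fin n → ℕ) (i : Fin n) :
    1 - q * spec q t u i ≠ 0 := by
  rw [spec, ← mul_assoc, ← pow_succ']
  exact hg.one_sub_ne_zero (by omega)

lemma normc_rot {N : ℕ} (v : Fin (N + 1) → ℕ) :
    normc q t (rot v) * (1 - q * spec q t v 0) = normc q t v * spec q t v 0 := by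
  have h1 := hg.cp_ne_zero v
  have h2 := hg.one_sub_q_mul_spec_ne_zero v 0
  rw [normc, normc, cp_rot, nstat'_rot, nstat_rot]
  field_simp
  rw [spec]
  ring

end IsGeneric

/-! ### Recursions for the interpolation polynomials -/

section Coefficients

variable {N : ℕ}

lemma coeff_unrotHom (q : ℂ) (u : Fin (N + 1) → ℕ) (p : MvPolynomial (Fin (N + 1)) ℂ) :
    coeff (Finsupp.equivFunOnFinite.symm (Fin.snoc (α := fun _ => ℕ) (fun i => u i.succ) (u 0)))
      (unrotHom q p) = (q ^ u 0)⁻¹ * coeff (Finsupp.equivFunOnFinite.symm u) p := by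
  induction p using MvPolynomial.induction_on' with
  | add p r hp hr => rw [map_add, coeff_add, hp, hr, coeff_add, mul_add]
  | monomial d a =>
    obtain ⟨e, rfl⟩ := Finsupp.equivFunOnFinite.symm.surjective d
    have h : unrotHom q (monomial (Finsupp.equivFunOnFinite.symm e) a) = monomial
        (Finsupp.equivFunOnFinite.symm (Fin.snoc (α := fun _ => ℕ) (fun i => e i.succ) (e 0)))
        ((q ^ e 0)⁻¹ * a) := by
      rw [unrotHom, aeval_monomial, monomial_eq, Finsupp.prod_fintype _ _ (by simp),
        Finsupp.prod_fintype _ _ (by simp), Fin.prod_univ_succ, Fin.prod_univ_castSucc, ← inv_pow, C_mul, C_pow]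
      simp [mul_pow, algebraMap_eq]
      ring
    have hinj : (Fin.snoc (α := fun _ => ℕ) (fun i => e i.succ) (e 0) : Fin (N + 1) → ℕ) =
        Fin.snoc (α := fun _ => ℕ) (fun i => u i.succ) (u 0) ↔ e = u := by
      refine ⟨fun h => ?_, fun h => by rw [h]⟩
      funext k
      refine Fin.cases ?_ (fun i => ?_) k
      · simpa using congrFun h (Fin.last N)
      · simpa using congrFun h i.castSucc
    classical
    rw [h, coeff_monomial, coeff_monomial]
    simp only [Finsupp.equivFunOnFinite.symm.injective.eq_iff, hinj]
    split_ifs with he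
    · rw [he]
    · simp

lemma coeff_eq_zero_of_totalDegree_lt_wt {n : ℕ} {p : MvPolynomial (Fin n) ℂ} {w : Fin n → ℕ}
    (h : p.totalDegree < wt w) : coeff (Finsupp.equivFunOnFinite.symm w) p = 0 := by
  refine coeff_eq_zero_of_totalDegree_lt (h.trans_le (le_of_eq ?_))
  exact (Finsupp.sum_fintype (Finsupp.equivFunOnFinite.symm w) (fun _ e => e) (by simp)).symm

lemma coeff_raise_rot (q : ℂ) (u : Fin (N + 1) → ℕ) {p : MvPolynomial (Fin (N + 1)) ℂ}
    (hp : p.totalDegree ≤ wt u) : coeff (Finsupp.equivFunOnFinite.symm (rot u)) (raise q p) =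
      (q ^ u 0)⁻¹ * coeff (Finsupp.equivFunOnFinite.symm u) p := by
  have h1 : Finsupp.equivFunOnFinite.symm (rot u) = Finsupp.single (Fin.last N) 1 +
      Finsupp.equivFunOnFinite.symm (Fin.snoc (α := fun _ => ℕ) (fun i => u i.succ) (u 0)) := by
    ext k
    refine Fin.lastCases ?_ (fun i => ?_) k
    · simp; ring
    · simp
  have h2 : raise q p = X (Fin.last N) * unrotHom q p - unrotHom q p := by
    simp [raise, sub_mul]
  rw [h2, coeff_sub, coeff_eq_zero_of_totalDegree_lt_wt (p := unrotHom q p), sub_zero, h1,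
    coeff_X_mul, coeff_unrotHom]
  rw [wt_rot]
  exact Order.lt_add_one_iff.2 ((totalDegree_unrotHom_le q p).trans hp)

lemma coeff_raise_of_last_eq_zero (q : ℂ) {w : Fin (N + 1) → ℕ} (hw : w (Fin.last N) = 0)
    {p : MvPolynomial (Fin (N + 1)) ℂ} (hp : p.totalDegree < wt w) :
    coeff (Finsupp.equivFunOnFinite.symm w) (raise q p) = 0 := by
  classical
  have h2 : raise q p = X (Fin.last N) * unrotHom q p - unrotHom q p := by
    simp [raise, sub_mul]
  rw [h2, coeff_sub, coeff_eq_zero_of_totalDegree_lt_wt (p := unrotHom q p), coeff_X_mul']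
  · simp [hw]
  · exact (totalDegree_unrotHom_le q p).trans_lt hp

lemma coeff_dl_of_eq_zero (t : ℂ) (i : Fin N) {w : Fin (N + 1) → ℕ} (hw : w i.succ = 0)
    (p : MvPolynomial (Fin (N + 1)) ℂ) :
    coeff (Finsupp.equivFunOnFinite.symm w) (dl t i p) =
      coeff (Finsupp.equivFunOnFinite.symm (w ∘ adj i)) p := by
  classical
  have h : Finsupp.equivFunOnFinite.symm w =
      Finsupp.mapDomain (adj i) (Finsupp.equivFunOnFinite.symm (w ∘ adj i)) := by
    ext k
    obtain ⟨m, rfl⟩ := (adj i).surjective k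
    rw [Finsupp.mapDomain_apply (adj i).injective]
    simp
  rw [dl_apply, coeff_add, coeff_smul, coeff_X_mul', if_neg (by simp [hw]), smul_zero, add_zero, h,
    coeff_rename_mapDomain _ (adj i).injective]

end Coefficients

/-- The value of `𝖬_u` at `⟨u⟩`. -/
def sigma {n : ℕ} (q t : ℂ) (u : Fin n → ℕ) : ℂ :=
  ∏ i, (-1) ^ u i * q ^ (u i).choose 2 * (t ^ (n - 1 - lp u i)) ^ u i

lemma sigma_rot {N : ℕ} (q t : ℂ) (u : Fin (N + 1) → ℕ) :
    sigma q t (rot u) = -(spec q t u 0 * sigma q t u) := by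
  have h : (u 0 + 1).choose 2 = u 0 + (u 0).choose 2 := by
    rw [Nat.choose_succ_succ' (u 0) 1, Nat.choose_one_right]
  rw [sigma, sigma, Fin.prod_univ_castSucc, Fin.prod_univ_succ]
  simp only [rot_castSucc, rot_last, lp_rot, finRotate_castSucc, finRotate_last, h, spec]
  ring

lemma sigma_comp_adj {N : ℕ} (q t : ℂ) {u : Fin (N + 1) → ℕ} (i : Fin N)
    (h : u i.castSucc ≠ u i.succ) : sigma q t (u ∘ adj i) = sigma q t u := by
  rw [sigma, sigma, ← Equiv.prod_comp (adj i) fun k => (-1) ^ u k * q ^ (u k).choose 2 *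
    (t ^ (N + 1 - 1 - lp u k)) ^ u k]
  simp [lp_comp_adj u i h]

lemma IsGeneric.sigma_ne_zero {q t : ℂ} (hg : IsGeneric q t) {n : ℕ} (u : Fin n → ℕ) :
    sigma q t u ≠ 0 :=
  Finset.prod_ne_zero_iff.2 fun _ _ => mul_ne_zero (mul_ne_zero (pow_ne_zero _ (by simp))
    (pow_ne_zero _ hg.q_ne)) (pow_ne_zero _ (pow_ne_zero _ hg.t_ne))

/-- The position of the last nonzero part. -/
lemma exists_last_ne_zero {n : ℕ} {u : Fin n → ℕ} (h : wt u ≠ 0) :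
    ∃ k, u k ≠ 0 ∧ ∀ m, k < m → u m = 0 := by
  have hne : (Finset.univ.filter fun k => u k ≠ 0).Nonempty := by
    by_contra hne
    rw [Finset.not_nonempty_iff_eq_empty, Finset.filter_eq_empty_iff] at hne
    exact h (Finset.sum_eq_zero fun k hk => by simpa using hne hk)
  refine ⟨_, (Finset.mem_filter.1 (Finset.max'_mem _ hne)).2, fun m hm => ?_⟩
  by_contra hm0
  exact (Finset.le_max' _ m (Finset.mem_filter.2 ⟨Finset.mem_univ _, hm0⟩)).not_gt hm

section Interp

variable {q t : ℂ} (hg : IsGeneric q t) {N : ℕ}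
  {M : (Fin (N + 1) → ℕ) → MvPolynomial (Fin (N + 1)) ℂ} (hM : IsInterpFamily q t M)

include hg in
lemma eq_smul_of_eval_spec_eq_zero {n : ℕ} {M : (Fin n → ℕ) → MvPolynomial (Fin n) ℂ}
    (hM : IsInterpFamily q t M) {f : MvPolynomial (Fin n) ℂ} {u : Fin n → ℕ}
    (hf : f.totalDegree ≤ wt u)
    (hv : ∀ w, wt w ≤ wt u → w ≠ u → eval (spec q t w) f = 0) :
    f = (eval (spec q t u) f / eval (spec q t u) (M u)) • M u := by
  refine eq_of_eval_spec hg hf ((totalDegree_smul_le _ _).trans (hM u).1) fun w hw => ?_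
  rw [smul_eval]
  by_cases h : w = u
  · rw [h, div_mul_cancel₀ _ (eval_spec_self_ne_zero hg hM u)]
  · rw [hv w hw h, (hM u).2.2 w hw h, mul_zero]

lemma eval_dl_spec (i : Fin N) (w : Fin (N + 1) → ℕ) (p : MvPolynomial (Fin (N + 1)) ℂ)
    (hg : IsGeneric q t) :
    eval (spec q t w) (dl t i p) = dlA t i (spec q t w) * eval (spec q t w) p +
      dlB t i (spec q t w) * eval (spec q t (w ∘ adj i)) p := by
  rw [eval_dl t i (hg.spec_ne w i)]
  by_cases h : w i.castSucc = w i.succ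
  · simp [dlB, spec_castSucc_of_eq q t w i h]
  · rw [spec_comp_adj q t w i h]

lemma IsGeneric.dlB_ne_zero (hg : IsGeneric q t) {i : Fin N} {u : Fin (N + 1) → ℕ}
    (h : u i.castSucc ≠ u i.succ) : dlB t i (spec q t u) ≠ 0 := by
  refine div_ne_zero (fun h0 => h ?_) (sub_ne_zero.2 (hg.spec_ne u i))
  rw [sub_eq_zero, spec, spec, mul_left_comm, ← pow_succ'] at h0
  exact (hg.pow_injective h0).1

include hg hM

lemma M_rot (u : Fin (N + 1) → ℕ) : M (rot u) = raise q (M u) := by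
  have h := eq_smul_of_eval_spec_eq_zero hg hM (f := raise q (M u)) (u := rot u)
    ((totalDegree_raise_le q _).trans (by rw [wt_rot]; exact Nat.add_le_add_right (hM u).1 1))
    fun w hw hwu => by
      by_cases hl : w (Fin.last N) = 0
      · exact eval_raise_eq_zero_of_last_eq_zero q t hl _
      · obtain ⟨v, rfl⟩ := exists_eq_rot w hl
        rw [wt_rot, wt_rot] at hw
        rw [eval_raise_rot hg.q_ne, (hM u).2.2 v (by omega) (fun h => hwu (by rw [h])), mul_zero]
  have hc := congrArg (coeff (Finsupp.equivFunOnFinite.symm (rot u))) h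
  rw [coeff_raise_rot q u (hM u).1, coeff_smul, (hM u).2.1, (hM _).2.1, nstat'_rot, pow_add,
    mul_inv, mul_comm, smul_eq_mul] at hc
  have hq : (q ^ nstat' u)⁻¹ * (q ^ u 0)⁻¹ ≠ 0 :=
    mul_ne_zero (inv_ne_zero (pow_ne_zero _ hg.q_ne)) (inv_ne_zero (pow_ne_zero _ hg.q_ne))
  rw [eq_comm, mul_eq_right₀ hq] at hc
  rw [h, hc, one_smul]

lemma dl_M_of_ne (i : Fin N) {u : Fin (N + 1) → ℕ} (h : u i.castSucc ≠ u i.succ) :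
    dl t i (M u) = dlA t i (spec q t u) • M u + (dlB t i (spec q t (u ∘ adj i)) *
      eval (spec q t u) (M u) / eval (spec q t (u ∘ adj i)) (M (u ∘ adj i))) • M (u ∘ adj i) := by
  have hne : u ∘ adj i ≠ u := by
    intro h'
    exact h (by simpa using (congrFun h' i.succ))
  have h1 := eq_smul_of_eval_spec_eq_zero hg hM (u := u ∘ adj i)
    (f := dl t i (M u) - dlA t i (spec q t u) • M u)
    (by
      rw [wt_comp]
      exact (totalDegree_sub _ _).trans (max_le ((totalDegree_dl_le _ _ _).trans (hM u).1)
        ((totalDegree_smul_le _ _).trans (hM u).1)))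
    fun w hw hwu => by
      rw [wt_comp] at hw
      rw [map_sub, eval_dl_spec i w _ hg, smul_eval]
      have hwu' : w ∘ adj i ≠ u := fun h' => hwu (by rw [← h', comp_adj_comp_adj])
      rw [(hM u).2.2 _ (by rwa [wt_comp]) hwu']
      by_cases hw' : w = u
      · rw [hw']; ring
      · rw [(hM u).2.2 _ hw hw']; ring
  rw [map_sub, eval_dl_spec i _ _ hg, smul_eval, comp_adj_comp_adj,
    (hM u).2.2 (u ∘ adj i) (wt_comp _ _).le hne] at h1
  rw [← sub_eq_iff_eq_add', h1]
  congr 2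
  ring

lemma dl_M_of_eq (i : Fin N) {u : Fin (N + 1) → ℕ} (h : u i.castSucc = u i.succ) :
    dl t i (M u) = M u := by
  have h1 := sub_ne_zero.2 (hg.spec_ne u i)
  have hA : dlA t i (spec q t u) = 1 := by
    rw [dlA, div_eq_one_iff_eq h1, spec_castSucc_of_eq q t u i h]; ring
  refine eq_of_eval_spec hg ((totalDegree_dl_le t i _).trans (hM u).1) (hM u).1 fun w hw => ?_
  rw [eval_dl_spec i w _ hg]
  by_cases hw' : w = u
  · rw [hw', hA, dlB, spec_castSucc_of_eq q t u i h]; simp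
  · have hwu' : w ∘ adj i ≠ u := by
      rintro rfl
      exact hw' (comp_adj_of_eq (by simpa using h.symm)).symm
    rw [(hM u).2.2 _ (by rwa [wt_comp]) hwu', (hM u).2.2 _ hw hw']; ring

lemma coeff_eq_zero_of_last_ne_zero (k : Fin (N + 1)) {u : Fin (N + 1) → ℕ} (hk : u k ≠ 0)
    (hk' : ∀ m, k < m → u m = 0) {w : Fin (N + 1) → ℕ} (hw : wt w = wt u)
    (hw' : ∀ m, k ≤ m → w m = 0) : coeff (Finsupp.equivFunOnFinite.symm w) (M u) = 0 := by
  induction k using Fin.reverseInduction generalizing u w with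
  | last =>
    obtain ⟨v, rfl⟩ := exists_eq_rot u hk
    rw [M_rot hg hM]
    refine coeff_raise_of_last_eq_zero q (hw' _ le_rfl) ?_
    rw [hw, wt_rot]
    exact Order.lt_add_one_iff.2 (hM v).1
  | cast i ih =>
    have hs : u i.succ = 0 := hk' _ Fin.castSucc_lt_succ
    have ih' {w : Fin (N + 1) → ℕ} (hw : wt w = wt u) (hw' : ∀ m, i.succ ≤ m → w m = 0) :
        coeff (Finsupp.equivFunOnFinite.symm w) (M (u ∘ adj i)) = 0 := by
      refine ih (by simpa using hk) (fun m hm => ?_) (by rw [hw, wt_comp]) hw'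
      have hm' : i.castSucc < m := Fin.castSucc_lt_succ.trans hm
      rw [Function.comp, adj_of_ne i hm'.ne' hm.ne', hk' m hm']
    have h1 := dl_M_of_ne hg hM i (u := u ∘ adj i) (by simpa [hs] using hk.symm)
    rw [comp_adj_comp_adj] at h1
    have hc := congrArg (coeff (Finsupp.equivFunOnFinite.symm w)) h1
    have hws : ∀ m, i.succ ≤ m → w m = 0 := fun m hm => hw' m (Fin.castSucc_lt_succ.le.trans hm)
    rw [coeff_dl_of_eq_zero t i (hw' _ Fin.castSucc_lt_succ.le), comp_adj_of_eq
      ((hw' _ le_rfl).trans (hw' _ Fin.castSucc_lt_succ.le).symm), coeff_add, coeff_smul,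
      coeff_smul, ih' hw hws, smul_zero, zero_add, smul_eq_mul, eq_comm, mul_eq_zero] at hc
    exact hc.resolve_left (div_ne_zero (mul_ne_zero (hg.dlB_ne_zero (by simpa [hs] using hk))
      (eval_spec_self_ne_zero hg hM _)) (eval_spec_self_ne_zero hg hM _))

lemma eval_M_comp_adj (i : Fin N) {u : Fin (N + 1) → ℕ} (h0 : u i.castSucc = 0)
    (hpos : u i.succ ≠ 0) (hu : ∀ m, i.succ < m → u m = 0) :
    eval (spec q t (u ∘ adj i)) (M (u ∘ adj i)) =
      dlB t i (spec q t (u ∘ adj i)) * eval (spec q t u) (M u) := by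
  have hc := congrArg (coeff (Finsupp.equivFunOnFinite.symm (u ∘ adj i)))
    (dl_M_of_ne hg hM i (u := u) (by rw [h0]; exact hpos.symm))
  rw [coeff_dl_of_eq_zero t i (by simpa using h0), coeff_add, coeff_smul, coeff_smul,
    comp_adj_comp_adj, coeff_eq_zero_of_last_ne_zero hg hM i.succ hpos hu (wt_comp _ _) fun m hm =>
      ?_, (hM u).2.1, (hM (u ∘ adj i)).2.1, nstat'_comp_adj, smul_zero, zero_add, eq_comm,
      smul_eq_mul, mul_eq_right₀ (inv_ne_zero (pow_ne_zero _ hg.q_ne)),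
      div_eq_one_iff_eq (eval_spec_self_ne_zero hg hM _)] at hc
  · exact hc.symm
  · rcases hm.eq_or_lt with rfl | hm
    · simpa using h0
    · rw [Function.comp, adj_of_ne i (Fin.castSucc_lt_succ.trans hm).ne' hm.ne', hu m hm]

omit hM in
lemma dlB_mul_normc (i : Fin N) {u : Fin (N + 1) → ℕ} (h0 : u i.castSucc = 0)
    (hpos : u i.succ ≠ 0) :
    normc q t (u ∘ adj i) * dlB t i (spec q t (u ∘ adj i)) = normc q t u := by
  set L := leg (u ∘ adj i) i.castSucc 0 with hL
  have hlp := lp_castSucc_of_zero i h0 (Nat.pos_of_ne_zero hpos)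
  have hlt := lp_lt u i.castSucc
  have hcp := cp_comp_adj q t i h0 (Nat.pos_of_ne_zero hpos)
  have hne : u i.castSucc ≠ u i.succ := by rw [h0]; exact hpos.symm
  have hc1 := hg.cp_ne_zero u
  have hc2 := hg.cp_ne_zero (u ∘ adj i)
  have ht := hg.t_ne
  have hs : spec q t u i.succ = q ^ u i.succ * t ^ (L + 1) * spec q t u i.castSucc := by
    rw [spec, spec, h0, show N + 1 - 1 - lp u i.succ = (N + 1 - 1 - lp u i.castSucc) + (L + 1) by
      omega]
    ring
  have hs0 := hg.spec_ne_zero u i.castSucc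
  have h1 := hg.one_sub_ne_zero (b := L + 1) hpos
  have h1' : q ^ u i.succ * t ^ (L + 1) - 1 ≠ 0 := by rw [← neg_sub]; exact neg_ne_zero.2 h1
  have hB : dlB t i (spec q t (u ∘ adj i)) * (1 - q ^ u i.succ * t ^ (L + 1)) =
      t * (1 - q ^ u i.succ * t ^ L) := by
    rw [spec_comp_adj q t u i hne, dlB]
    simp only [Function.comp, adj_castSucc, adj_succ, hs]
    rw [← sub_one_mul, ← sub_mul, mul_div_mul_right _ _ hs0, div_mul_eq_mul_div, div_eq_iff h1']
    ring
  rw [normc, normc, nstat'_comp_adj, nstat_comp_adj i h0 (Nat.pos_of_ne_zero hpos),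
    div_mul_eq_mul_div, div_eq_div_iff hc2 hc1]
  refine mul_right_cancel₀ h1 ?_
  linear_combination (q ^ nstat' u * t ^ nstat (u ∘ adj i) * cp q t u) * hB +
    (q ^ nstat' u * t ^ nstat (u ∘ adj i) * t) * hcp

lemma eval_MM_self (u : Fin (N + 1) → ℕ) : eval (spec q t u) (MM q t M u) = sigma q t u := by
  induction hd : wt u generalizing u with
  | zero =>
    have hu : u = 0 := by
      funext k; simpa using (Finset.sum_eq_zero_iff.1 hd) k (Finset.mem_univ _)
    subst hu
    have h1 := totalDegree_eq_zero_iff_eq_C.1 (Nat.le_zero.1 ((hM 0).1.trans hd.le))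
    have h2 := (hM 0).2.1
    have h3 : (Finsupp.equivFunOnFinite.symm (0 : Fin (N + 1) → ℕ)) = 0 := by ext; simp
    rw [h3] at h2
    rw [MM_eq, smul_eval, h1, h2]
    simp [normc, sigma, nstat', nstat, cp]
  | succ d ih =>
    obtain ⟨k, hk, hk'⟩ := exists_last_ne_zero (u := u) (by omega)
    induction k using Fin.reverseInduction generalizing u with
    | last =>
      obtain ⟨v, rfl⟩ := exists_eq_rot u hk
      rw [wt_rot] at hd
      rw [sigma_rot, ← ih v (by omega), MM_eq, MM_eq, M_rot hg hM, smul_eval, smul_eval,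
        eval_raise_rot hg.q_ne]
      linear_combination -(eval (spec q t v) (M v)) * hg.normc_rot v
    | cast i ihk =>
      have hs : u i.succ = 0 := hk' _ Fin.castSucc_lt_succ
      have h0 : (u ∘ adj i) i.castSucc = 0 := by simpa using hs
      have hpos : (u ∘ adj i) i.succ ≠ 0 := by simpa using hk
      have hz : ∀ m, i.succ < m → (u ∘ adj i) m = 0 := fun m hm => by
        have hm' : i.castSucc < m := Fin.castSucc_lt_succ.trans hm
        rw [Function.comp, adj_of_ne i hm'.ne' hm.ne', hk' m hm']
      have h1 := ihk (u ∘ adj i) (by rwa [wt_comp]) hpos hz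
      have h2 := eval_M_comp_adj hg hM i h0 hpos hz
      have h3 := dlB_mul_normc hg i h0 hpos
      rw [comp_adj_comp_adj] at h2 h3
      rw [MM_eq, smul_eval, ← h3, sigma_comp_adj q t i (by rw [hs]; exact hk)] at h1
      rw [MM_eq, smul_eval, h2, ← h1]
      ring

end Interp

/-! ### Commuting operators and the extra vanishing property -/

section Cherednik

variable {N : ℕ}

/-- The product `T_j⁻¹ T_{j+1}⁻¹ ⋯ T_{k-1}⁻¹`. -/
def dlProd (t : ℂ) (j k : Fin (N + 1)) : Module.End ℂ (MvPolynomial (Fin (N + 1)) ℂ) :=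
  Fin.induction (motive := fun _ => Module.End ℂ (MvPolynomial (Fin (N + 1)) ℂ)) 1
    (fun i P => if j ≤ i.castSucc then P * dlInv t i else 1) k

lemma dlProd_self (t : ℂ) (j : Fin (N + 1)) : dlProd t j j = 1 := by
  refine Fin.cases ?_ (fun i => ?_) j
  · rfl
  · rw [dlProd, Fin.induction_succ, if_neg Fin.castSucc_lt_succ.not_ge]

lemma dlProd_succ (t : ℂ) {j : Fin (N + 1)} {i : Fin N} (h : j ≤ i.castSucc) :
    dlProd t j i.succ = dlProd t j i.castSucc * dlInv t i := by
  rw [dlProd, Fin.induction_succ, if_pos h]; rfl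

lemma dlProd_induction (t : ℂ) (j : Fin (N + 1))
    {P : Fin (N + 1) → Module.End ℂ (MvPolynomial (Fin (N + 1)) ℂ) → Prop}
    (h1 : P j 1) (hs : ∀ i : Fin N, ∀ D, j ≤ i.castSucc → P i.castSucc D →
      P i.succ (D * dlInv t i)) {k : Fin (N + 1)} (hk : j ≤ k) : P k (dlProd t j k) := by
  induction k using Fin.induction with
  | zero =>
    obtain rfl := Fin.le_zero_iff.1 hk
    rwa [dlProd_self]
  | succ i ih =>
    rcases hk.eq_or_lt with rfl | h
    · rwa [dlProd_self]
    · rw [← Fin.le_castSucc_iff] at h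
      rw [dlProd_succ t h]
      exact hs i _ h (ih h)

lemma insertNth_comp_adj (i : Fin N) (z : Fin N → ℂ) :
    (i.castSucc.insertNth (α := fun _ => ℂ) 0 z) ∘ adj i = i.succ.insertNth (α := fun _ => ℂ) 0 z := by
  rw [Fin.eq_insertNth_iff]
  refine ⟨by simp, ?_⟩
  funext j
  have : adj i (i.succ.succAbove j) = i.castSucc.succAbove j := by
    refine Fin.ext ?_
    rw [adj_val]
    simp only [Fin.succAbove, Fin.lt_def, Fin.val_castSucc, Fin.val_succ]
    split_ifs <;> simp at * <;> omega
  simp only [Fin.removeNth, Function.comp, this, Fin.insertNth_apply_succAbove]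

lemma eval_insertNth_dlProd (t : ℂ) {j k : Fin (N + 1)} (hjk : j ≤ k) (z : Fin N → ℂ)
    (p : MvPolynomial (Fin (N + 1)) ℂ) :
    eval (j.insertNth (α := fun _ => ℂ) 0 z) (dlProd t j k p) =
      eval (k.insertNth (α := fun _ => ℂ) 0 z) p := by
  refine dlProd_induction t j (P := fun k D => ∀ p, eval (j.insertNth (α := fun _ => ℂ) 0 z) (D p) =
      eval (k.insertNth (α := fun _ => ℂ) 0 z) p) (fun p => rfl) (fun i D _ h p => ?_) hjk p
  rw [Module.End.mul_apply, h, eval_dlInv_of_eq_zero _ _ (by simp), insertNth_comp_adj]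

lemma totalDegree_dlInv_le (t : ℂ) (i : Fin N) (p : MvPolynomial (Fin (N + 1)) ℂ) :
    (dlInv t i p).totalDegree ≤ p.totalDegree :=
  (totalDegree_add _ _).trans (max_le (totalDegree_rename_le _ _)
    ((totalDegree_smul_le _ _).trans (totalDegree_X_mul_ddiff_le _ _ _)))

lemma totalDegree_dlProd_le (t : ℂ) {j k : Fin (N + 1)} (hjk : j ≤ k)
    (p : MvPolynomial (Fin (N + 1)) ℂ) : (dlProd t j k p).totalDegree ≤ p.totalDegree :=
  dlProd_induction t j (P := fun _ D => ∀ p, (D p).totalDegree ≤ p.totalDegree)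
    (fun _ => le_rfl) (fun i _ _ h p => (h _).trans (totalDegree_dlInv_le t i p)) hjk p

lemma eval_dlInv_spec {q t : ℂ} (hg : IsGeneric q t) (i : Fin N) (w : Fin (N + 1) → ℕ)
    (p : MvPolynomial (Fin (N + 1)) ℂ) :
    eval (spec q t w) (dlInv t i p) = t⁻¹ * ((dlA t i (spec q t w) + t - 1) * eval (spec q t w) p +
      dlB t i (spec q t w) * eval (spec q t (w ∘ adj i)) p) := by
  rw [eval_dlInv hg.t_ne i (hg.spec_ne w i)]
  by_cases h : w i.castSucc = w i.succ
  · simp [dlB, spec_castSucc_of_eq q t w i h]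
  · rw [spec_comp_adj q t w i h]

lemma eval_dlProd_spec_eq_zero {q t : ℂ} (hg : IsGeneric q t) {j k : Fin (N + 1)} (hjk : j ≤ k)
    {S : Set (Fin (N + 1) → ℕ)} (hS : ∀ w ∈ S, ∀ i : Fin N, w ∘ adj i ∈ S)
    {p : MvPolynomial (Fin (N + 1)) ℂ} (hp : ∀ w ∈ S, eval (spec q t w) p = 0) :
    ∀ w ∈ S, eval (spec q t w) (dlProd t j k p) = 0 := by
  refine dlProd_induction t j (P := fun _ D => ∀ p : MvPolynomial (Fin (N + 1)) ℂ,
    (∀ w ∈ S, eval (spec q t w) p = 0) → ∀ w ∈ S, eval (spec q t w) (D p) = 0)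
    (fun p hp => hp) (fun i D _ h p hp => h _ fun w hw => ?_) hjk p hp
  rw [eval_dlInv_spec hg, hp w hw, hp _ (hS w hw i), mul_zero, mul_zero, add_zero, mul_zero]

/-- The inhomogeneous Cherednik operator, in the normalization with eigenvalue
`x_j / ⟨v⟩_j - 1` on `M_v`. -/
def cherednik (q t : ℂ) (j : Fin (N + 1)) : Module.End ℂ (MvPolynomial (Fin (N + 1)) ℂ) :=
  dlProd t j (Fin.last N) * raise q * dlProd t 0 j

lemma totalDegree_cherednik_le (q t : ℂ) (j : Fin (N + 1)) (p : MvPolynomial (Fin (N + 1)) ℂ) :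
    (cherednik q t j p).totalDegree ≤ p.totalDegree + 1 :=
  (totalDegree_dlProd_le t (Fin.le_last j) _).trans ((totalDegree_raise_le q _).trans
    (Nat.add_le_add_right (totalDegree_dlProd_le t (Fin.zero_le j) p) 1))

lemma X_dvd_cherednik_add (q t : ℂ) (j : Fin (N + 1)) (p : MvPolynomial (Fin (N + 1)) ℂ) :
    X j ∣ cherednik q t j p + p := by
  let φ : MvPolynomial (Fin (N + 1)) ℂ →ₐ[ℂ] MvPolynomial (Fin (N + 1)) ℂ :=
    aeval (j.insertNth (α := fun _ => MvPolynomial (Fin (N + 1)) ℂ) 0 fun i => X (j.succAbove i))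
  have h0 : φ (cherednik q t j p + p) = 0 := by
    refine MvPolynomial.funext fun x => ?_
    have hx : (fun k => eval x (j.insertNth (α := fun _ => MvPolynomial (Fin (N + 1)) ℂ) 0
        (fun i => X (j.succAbove i)) k)) =
        j.insertNth (α := fun _ => ℂ) 0 fun i => x (j.succAbove i) := by
      rw [Fin.eq_insertNth_iff]
      refine ⟨by simp, funext fun i => by simp [Fin.removeNth]⟩
    have hu (z : Fin N → ℂ) : unrotPt q ((Fin.last N).insertNth (α := fun _ => ℂ) 0 z) =
        (0 : Fin (N + 1)).insertNth (α := fun _ => ℂ) 0 z := by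
      funext k
      refine Fin.cases ?_ (fun i => ?_) k
      · simp [unrotPt]
      · simp [unrotPt, Fin.insertNth_last', Fin.insertNth_zero']
    rw [map_zero, eval_aeval, hx, map_add, cherednik, Module.End.mul_apply, Module.End.mul_apply,
      eval_insertNth_dlProd t (Fin.le_last j), eval_raise, Fin.insertNth_apply_same, hu,
      eval_insertNth_dlProd t (Fin.zero_le j)]
    ring
  have := dvd_sub_algHom φ (d := X j) (fun k => ?_) (cherednik q t j p + p)
  · rwa [h0, sub_zero] at this
  · by_cases hk : k = j
    · subst hk; simp [φ]
    · obtain ⟨i, rfl⟩ := Fin.exists_succAbove_eq hk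
      simp [φ]

lemma eval_cherednik_spec_eq_zero {q t : ℂ} (hg : IsGeneric q t) (j : Fin (N + 1))
    {S S' : Set (Fin (N + 1) → ℕ)} (hS : ∀ w ∈ S, ∀ i : Fin N, w ∘ adj i ∈ S)
    (hS' : ∀ w ∈ S', ∀ i : Fin N, w ∘ adj i ∈ S') (hrot : ∀ w, rot w ∈ S' → w ∈ S)
    {p : MvPolynomial (Fin (N + 1)) ℂ} (hp : ∀ w ∈ S, eval (spec q t w) p = 0) :
    ∀ w ∈ S', eval (spec q t w) (cherednik q t j p) = 0 := by
  refine eval_dlProd_spec_eq_zero hg (Fin.le_last j) hS' fun w hw => ?_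
  by_cases hl : w (Fin.last N) = 0
  · exact eval_raise_eq_zero_of_last_eq_zero q t hl _
  · obtain ⟨v, rfl⟩ := exists_eq_rot w hl
    rw [eval_raise_rot hg.q_ne, eval_dlProd_spec_eq_zero hg (Fin.zero_le j) hS hp v (hrot v hw),
      mul_zero]

variable {q t : ℂ} (hg : IsGeneric q t) {M : (Fin (N + 1) → ℕ) → MvPolynomial (Fin (N + 1)) ℂ}
  (hM : IsInterpFamily q t M)
include hg hM

lemma cherednik_M (j : Fin (N + 1)) (v : Fin (N + 1) → ℕ) :
    cherednik q t j (M v) = (C (spec q t v j)⁻¹ * X j - 1) * M v := by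
  have hz := eval_cherednik_spec_eq_zero hg j (S := {w | wt w < wt v}) (S' := {w | wt w ≤ wt v})
    (p := M v) (fun w hw i => (wt_comp w _).trans_lt hw) (fun w hw i => (wt_comp w _).trans_le hw)
    (fun w hw => by simpa [wt_rot, Nat.succ_le_iff] using hw)
    (fun w hw => (hM v).2.2 w (le_of_lt hw) (fun h => (ne_of_lt (show wt w < wt v from hw)) (by rw [h])))
  obtain ⟨g, hgg⟩ := X_dvd_cherednik_add q t j (M v)
  have hev (w) (hw : wt w ≤ wt v) :
      eval (spec q t w) g = (spec q t w j)⁻¹ * eval (spec q t w) (M v) := by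
    have := congrArg (eval (spec q t w)) hgg
    rw [map_add, hz w hw, zero_add, map_mul, eval_X] at this
    rw [this, inv_mul_cancel_left₀ (hg.spec_ne_zero w j)]
  have hgdeg : g.totalDegree ≤ wt v := by
    by_cases h0 : g = 0
    · simp [h0]
    have h1 := totalDegree_lt_of_mul_eq (i := j) (by simp) hgg h0
    have h2 := (totalDegree_add (cherednik q t j (M v)) (M v)).trans (max_le
      ((totalDegree_cherednik_le q t j (M v)).trans (Nat.add_le_add_right (hM v).1 1))
      ((hM v).1.trans (Nat.le_succ _)))
    omega
  have : g = (spec q t v j)⁻¹ • M v := by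
    refine eq_of_eval_spec hg hgdeg ((totalDegree_smul_le _ _).trans (hM v).1) fun w hw => ?_
    rw [hev w hw, smul_eval]
    by_cases h : w = v
    · rw [h]
    · rw [(hM v).2.2 w hw h, mul_zero, mul_zero]
  rw [this, smul_eq_C_mul] at hgg
  linear_combination hgg

lemma eval_spec_M_eq_zero {v : Fin (N + 1) → ℕ} :
    ∀ {w : Fin (N + 1) → ℕ}, ¬Contained v w → eval (spec q t w) (M v) = 0 := by
  intro w
  induction hd : wt w using Nat.strong_induction_on generalizing w with
  | _ d ih =>
  subst hd
  intro hvw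
  have hadj {w : Fin (N + 1) → ℕ} (i : Fin N) (h : ¬Contained v w) : ¬Contained v (w ∘ adj i) :=
    fun h' => h (by simpa [comp_adj_comp_adj] using h'.comp_adj i)
  by_contra hne
  have hw : w = v := by
    refine hg.spec_injective (funext fun j => ?_)
    have hz := eval_cherednik_spec_eq_zero hg j (S := {w' | wt w' < wt w ∧ ¬Contained v w'})
      (S' := {w' | wt w' ≤ wt w ∧ ¬Contained v w'}) (p := M v)
      (fun w hw i => ⟨(wt_comp w _).trans_lt hw.1, hadj i hw.2⟩)
      (fun w hw i => ⟨(wt_comp w _).trans_le hw.1, hadj i hw.2⟩)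
      (fun w hw => ⟨by simpa [wt_rot, Nat.succ_le_iff] using hw.1, fun h => hw.2 h.rot⟩)
      (fun w hw => ih _ hw.1 rfl hw.2) w ⟨le_rfl, hvw⟩
    rw [cherednik_M hg hM, map_mul, mul_eq_zero, or_iff_left hne] at hz
    have hv := hg.spec_ne_zero v j
    simp only [map_sub, map_mul, eval_C, eval_X, map_one, sub_eq_zero] at hz
    rwa [inv_mul_eq_one₀ hv, eq_comm] at hz
  exact hvw (hw ▸ Contained.refl v)

end Cherednik

/-! ### Growth of the normalized interpolation polynomials -/

lemma exists_pos_le_of_cofinite {ι : Type*} {g : ι → ℝ} {c : ℝ} (hc : 0 < c) (hpos : ∀ x, 0 < g x)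
    (h : ∀ᶠ x in Filter.cofinite, c ≤ g x) : ∃ δ > 0, ∀ x, δ ≤ g x := by
  rw [Filter.eventually_cofinite] at h
  by_cases hne : h.toFinset.Nonempty
  · obtain ⟨x₀, -, hx₀⟩ := Finset.exists_min_image _ g hne
    refine ⟨min c (g x₀), lt_min hc (hpos _), fun x => ?_⟩
    by_cases hx : c ≤ g x
    · exact (min_le_left _ _).trans hx
    · exact (min_le_right _ _).trans (hx₀ x (by simpa using hx))
  · refine ⟨c, hc, fun x => ?_⟩
    by_contra hx
    exact hne ⟨x, by simpa using hx⟩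

open Filter Topology in
lemma eventually_le_norm_one_sub {q c : ℂ} (hq0 : q ≠ 0) (hq : ‖q‖ < 1) (hc : c ≠ 0) :
    ∀ᶠ k : ℤ in cofinite, 1 / 2 ≤ ‖1 - q ^ k * c‖ := by
  have hpos : 0 < ‖q‖ := norm_pos_iff.2 hq0
  have hc' : 0 < ‖c‖ := norm_pos_iff.2 hc
  have h0 := tendsto_pow_atTop_nhds_zero_of_lt_one hpos.le hq
  have h1 : Tendsto (fun k : ℕ => ‖q‖ ^ k * ‖c‖) atTop (𝓝 0) := by
    simpa using h0.mul_const ‖c‖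
  have h2 : Tendsto (fun k : ℕ => 2 * ‖q‖ ^ k) atTop (𝓝 0) := by
    simpa using h0.const_mul 2
  obtain ⟨n₁, hn₁⟩ := eventually_atTop.1 (h1.eventually_lt_const (show (0 : ℝ) < 1 / 2 by norm_num))
  obtain ⟨n₂, hn₂⟩ := eventually_atTop.1 (h2.eventually_lt_const hc')
  rw [Int.cofinite_eq, eventually_sup]
  constructor
  · filter_upwards [eventually_le_atBot (-n₂ : ℤ)] with k hk
    obtain ⟨m, rfl⟩ := Int.exists_eq_neg_ofNat (a := k) (by omega)
    have h := hn₂ m (by omega)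
    have h3 : 2 ≤ ‖q ^ (-(m : ℤ)) * c‖ := by
      rw [norm_mul, zpow_neg, zpow_natCast, norm_inv, norm_pow, inv_mul_eq_div,
        le_div_iff₀ (pow_pos hpos m)]
      exact h.le
    have := norm_sub_norm_le (q ^ (-(m : ℤ)) * c) 1
    rw [norm_one, norm_sub_rev] at this
    linarith
  · filter_upwards [eventually_ge_atTop (n₁ : ℤ)] with k hk
    lift k to ℕ using (by omega)
    have h := hn₁ k (by omega)
    have := norm_sub_norm_le 1 (q ^ (k : ℤ) * c)
    rw [norm_one, norm_mul, zpow_natCast, norm_pow] at this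
    rw [zpow_natCast]
    linarith

namespace IsGeneric

variable {q t : ℂ} (hg : IsGeneric q t) (hq : ‖q‖ < 1)
include hg hq

/-- The numbers `1 - q^a t^b` are bounded away from zero for bounded `b`. -/
lemma exists_pos_le_norm (B : ℕ) : ∃ δ > 0, ∀ a b : ℤ, |b| ≤ B → ¬(a = 0 ∧ b = 0) →
    δ ≤ ‖1 - q ^ a * t ^ b‖ := by
  have h1 (b : ℤ) : ∃ δ > 0, ∀ a : ℤ, δ ≤ if a = 0 ∧ b = 0 then 1 else ‖1 - q ^ a * t ^ b‖ := by
    refine exists_pos_le_of_cofinite (c := 1 / 2) (by norm_num) (fun a => ?_) ?_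
    · split_ifs with h
      · exact one_pos
      · exact norm_pos_iff.2 (sub_ne_zero.2 (hg.ne_one a b h).symm)
    · filter_upwards [eventually_le_norm_one_sub hg.q_ne hq (zpow_ne_zero b hg.t_ne)] with a ha
      split_ifs
      · norm_num
      · exact ha
  choose δ hδ hδ' using h1
  obtain ⟨b₀, -, hb₀⟩ := Finset.exists_min_image (Finset.Icc (-(B : ℤ)) B) δ ⟨0, by simp⟩
  refine ⟨δ b₀, hδ b₀, fun a b hb hab => (hb₀ b ?_).trans ?_⟩
  · rwa [Finset.mem_Icc, ← abs_le]
  · simpa [hab] using hδ' b a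

lemma exists_bounds (N : ℕ) : ∃ K : ℝ, 0 ≤ K ∧ ∀ (i : Fin N) (u : Fin (N + 1) → ℕ),
    ‖dlA t i (spec q t u)‖ ≤ K ∧ ‖dlA t i (spec q t u) + t - 1‖ ≤ K ∧
    ‖dlB t i (spec q t u)‖ ≤ K ∧
    (u i.castSucc ≠ u i.succ → ‖(dlB t i (spec q t u))⁻¹‖ ≤ K) := by
  obtain ⟨δ, hδ, h⟩ := hg.exists_pos_le_norm hq (N + 1)
  set K₁ := ‖t - 1‖ / δ
  have hK₁ : 0 ≤ K₁ := by positivity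
  refine ⟨K₁ + ‖t - 1‖ + ‖t‖ + ‖t‖⁻¹ * (1 + K₁), by positivity, fun i u => ?_⟩
  have n0 := norm_nonneg (t - 1)
  have n1 := norm_nonneg t
  have n2 : 0 ≤ ‖t‖⁻¹ * (1 + K₁) := by positivity
  have hs0 := hg.spec_ne_zero u i.castSucc
  have hlt1 := lp_lt u i.castSucc
  have hlt2 := lp_lt u i.succ
  have hq0 := hg.q_ne
  have ht0 := hg.t_ne
  obtain ⟨r, a, b, hr, hab, hb, hrab, ha⟩ : ∃ (r : ℂ) (a b : ℤ), spec q t u i.succ =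
      r * spec q t u i.castSucc ∧ ¬(a = 0 ∧ b = 0) ∧ |b| ≤ N ∧ r = q ^ a * t ^ b ∧
      (u i.castSucc ≠ u i.succ → a ≠ 0) := by
    refine ⟨q ^ ((u i.succ : ℤ) - u i.castSucc) * t ^ ((lp u i.castSucc : ℤ) - lp u i.succ),
      _, _, ?_, ?_, ?_, rfl, by omega⟩
    · have e : ((N + 1 - 1 - lp u i.succ : ℕ) : ℤ) = (lp u i.castSucc : ℤ) - lp u i.succ +
          (N + 1 - 1 - lp u i.castSucc : ℕ) := by omega
      have e' : t ^ (N + 1 - 1 - lp u i.succ) = t ^ ((lp u i.castSucc : ℤ) - lp u i.succ) *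
          t ^ (N + 1 - 1 - lp u i.castSucc) := by
        rw [← zpow_natCast, e, zpow_add₀ ht0, zpow_natCast]
      have e'' : q ^ u i.succ = q ^ ((u i.succ : ℤ) - u i.castSucc) * q ^ u i.castSucc := by
        rw [← zpow_natCast q (u i.castSucc), ← zpow_add₀ hq0, sub_add_cancel, zpow_natCast]
      rw [spec, spec, e', e'']
      ring
    · rintro ⟨h1, h2⟩
      refine hg.spec_ne u i ?_
      rw [spec, spec, show u i.castSucc = u i.succ by omega,
        show lp u i.castSucc = lp u i.succ by omega]
    · rw [abs_le]; omega
  have hd1 : δ ≤ ‖1 - r‖ := by rw [hrab]; exact h a b (by push_cast; omega) hab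
  have hr1 : 1 - r ≠ 0 := norm_pos_iff.1 (hδ.trans_le hd1)
  have hA : dlA t i (spec q t u) = (t - 1) / (1 - r) - (t - 1) := by
    rw [dlA, hr, ← one_sub_mul, ← mul_assoc, mul_div_mul_right _ _ hs0]
    field_simp
    ring
  have hB : dlB t i (spec q t u) = t - (t - 1) / (1 - r) := by
    rw [dlB, hr, ← one_sub_mul, ← mul_assoc, ← one_sub_mul, mul_div_mul_right _ _ hs0]
    field_simp
    ring
  have hE : ‖(t - 1) / (1 - r)‖ ≤ K₁ := by
    rw [norm_div]
    exact div_le_div_of_nonneg_left n0 hδ hd1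
  refine ⟨?_, ?_, ?_, fun hu => ?_⟩
  · rw [hA]
    linarith [norm_sub_le ((t - 1) / (1 - r)) (t - 1)]
  · rw [hA, show (t - 1) / (1 - r) - (t - 1) + t - 1 = (t - 1) / (1 - r) by ring]
    linarith
  · rw [hB]
    linarith [norm_sub_le t ((t - 1) / (1 - r))]
  · have hd2 : δ ≤ ‖1 - t * r‖ := by
      have := h a (b + 1) (by rw [abs_le] at hb ⊢; push_cast; omega) (fun h => ha hu h.1)
      rwa [zpow_add_one₀ ht0, ← mul_assoc, ← hrab, mul_comm r] at this
    have hr2 : 1 - t * r ≠ 0 := norm_pos_iff.1 (hδ.trans_le hd2)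
    have hB' : (dlB t i (spec q t u))⁻¹ = t⁻¹ * (1 + (t - 1) / (1 - t * r)) := by
      rw [dlB, hr, ← one_sub_mul, ← mul_assoc, ← one_sub_mul, mul_div_mul_right _ _ hs0]
      field_simp
      ring
    have hE' : ‖(t - 1) / (1 - t * r)‖ ≤ K₁ := by
      rw [norm_div]
      exact div_le_div_of_nonneg_left n0 hδ hd2
    have : ‖t⁻¹ * (1 + (t - 1) / (1 - t * r))‖ ≤ ‖t‖⁻¹ * (1 + K₁) := by
      rw [norm_mul, norm_inv]
      refine mul_le_mul_of_nonneg_left ((norm_add_le _ _).trans ?_) (by positivity)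
      rw [norm_one]
      linarith
    rw [hB']
    linarith

end IsGeneric

lemma norm_spec_le {n : ℕ} {q : ℂ} (hq : ‖q‖ < 1) (t : ℂ) (u : Fin n → ℕ) (i : Fin n) :
    ‖spec q t u i‖ ≤ max 1 ‖t‖ ^ n := by
  rw [spec, norm_mul, norm_pow, norm_pow]
  calc _ ≤ 1 * max 1 ‖t‖ ^ (n - 1 - lp u i) :=
        mul_le_mul (pow_le_one₀ (norm_nonneg _) hq.le)
          (pow_le_pow_left₀ (norm_nonneg _) (le_max_right _ _) _) (by positivity) zero_le_one
    _ ≤ max 1 ‖t‖ ^ n := by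
        rw [one_mul]
        exact pow_le_pow_right₀ (le_max_left _ _) (by omega)

/-- The product `T_{k-1} ⋯ T_2 T_1`. -/
def dlChain {N : ℕ} (t : ℂ) (k : Fin (N + 1)) : Module.End ℂ (MvPolynomial (Fin (N + 1)) ℂ) :=
  Fin.induction (motive := fun _ => Module.End ℂ (MvPolynomial (Fin (N + 1)) ℂ)) 1
    (fun i P => dl t i * P) k

lemma dlChain_succ {N : ℕ} (t : ℂ) (i : Fin N) :
    dlChain t i.succ = dl t i * dlChain t i.castSucc := rfl

lemma dlProd_mul_dlChain {N : ℕ} {t : ℂ} (ht : t ≠ 0) (k : Fin (N + 1)) :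
    dlProd t 0 k * dlChain t k = 1 := by
  induction k using Fin.induction with
  | zero => rw [dlProd_self]; rfl
  | succ i ih =>
    rw [dlProd_succ t (Fin.zero_le _), dlChain_succ, mul_assoc, ← mul_assoc (dlInv t i),
      dlInv_mul_dl ht, one_mul, ih]

section Growth

variable {q t : ℂ} (hg : IsGeneric q t) {N : ℕ}
  {M : (Fin (N + 1) → ℕ) → MvPolynomial (Fin (N + 1)) ℂ} (hM : IsInterpFamily q t M)
include hg hM

lemma dl_MM_of_ne (i : Fin N) {u : Fin (N + 1) → ℕ} (h : u i.castSucc ≠ u i.succ) :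
    dl t i (MM q t M u) = dlA t i (spec q t u) • MM q t M u +
      dlB t i (spec q t (u ∘ adj i)) • MM q t M (u ∘ adj i) := by
  have h1 := eval_MM_self hg hM u
  have h2 := eval_MM_self hg hM (u ∘ adj i)
  rw [sigma_comp_adj q t i h, ← h1, MM_eq, MM_eq, smul_eval, smul_eval] at h2
  have h3 := eval_spec_self_ne_zero hg hM (u ∘ adj i)
  rw [MM_eq, MM_eq, map_smul, dl_M_of_ne hg hM i h, smul_add, smul_smul, smul_smul, smul_smul,
    smul_smul]
  congr 2
  · ring
  · rw [mul_div_assoc', div_eq_iff h3]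
    linear_combination -(dlB t i (spec q t (u ∘ adj i))) * h2

lemma dl_MM_of_eq (i : Fin N) {u : Fin (N + 1) → ℕ} (h : u i.castSucc = u i.succ) :
    dl t i (MM q t M u) = MM q t M u := by
  rw [MM_eq, map_smul, dl_M_of_eq hg hM i h]

lemma dlInv_MM_of_eq (i : Fin N) {u : Fin (N + 1) → ℕ} (h : u i.castSucc = u i.succ) :
    dlInv t i (MM q t M u) = MM q t M u := by
  conv_lhs => rw [← dl_MM_of_eq hg hM i h]
  rw [← Module.End.mul_apply, dlInv_mul_dl hg.t_ne, Module.End.one_apply]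

omit hM in
lemma dlInv_eq (i : Fin N) (p : MvPolynomial (Fin (N + 1)) ℂ) :
    dlInv t i p = t⁻¹ • (dl t i p + (t - 1) • p) := by
  refine ext_of_ne i fun x hx => ?_
  rw [eval_dlInv hg.t_ne i hx, smul_eval, map_add, eval_dl t i hx, smul_eval]
  ring

lemma dlInv_MM_of_ne (i : Fin N) {u : Fin (N + 1) → ℕ} (h : u i.castSucc ≠ u i.succ) :
    dlInv t i (MM q t M u) = (t⁻¹ * (dlA t i (spec q t u) + t - 1)) • MM q t M u +
      (t⁻¹ * dlB t i (spec q t (u ∘ adj i))) • MM q t M (u ∘ adj i) := by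
  rw [dlInv_eq hg, dl_MM_of_ne hg hM i h]
  module

lemma raise_MM (v : Fin (N + 1) → ℕ) : spec q t v 0 • raise q (MM q t M v) =
    (1 - q * spec q t v 0) • MM q t M (rot v) := by
  rw [MM_eq, MM_eq, map_smul, M_rot hg hM, smul_smul, smul_smul, mul_comm, ← hg.normc_rot v,
    mul_comm]

lemma spec_mul_eval_cherednik_MM (j : Fin (N + 1)) (v : Fin (N + 1) → ℕ) (x : Fin (N + 1) → ℂ) :
    spec q t v j * eval x (cherednik q t j (MM q t M v)) =
      (x j - spec q t v j) * eval x (MM q t M v) := by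
  have h := hg.spec_ne_zero v j
  rw [MM_eq, map_smul, cherednik_M hg hM, smul_eval, smul_eval]
  simp only [map_mul, map_sub, eval_C, eval_X, map_one]
  field_simp

lemma dlProd_MM_of_zero {j k : Fin (N + 1)} (hjk : j ≤ k) {u : Fin (N + 1) → ℕ}
    (hu : ∀ m, j ≤ m → m ≤ k → u m = 0) : dlProd t j k (MM q t M u) = MM q t M u := by
  refine dlProd_induction t j (P := fun k D => (∀ m, j ≤ m → m ≤ k → u m = 0) →
    D (MM q t M u) = MM q t M u) (fun _ => rfl) (fun i D hij h hu => ?_) hjk hu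
  rw [Module.End.mul_apply, dlInv_MM_of_eq hg hM i]
  · exact h fun m hm hm' => hu m hm (hm'.trans Fin.castSucc_lt_succ.le)
  · rw [hu _ hij Fin.castSucc_lt_succ.le, hu _ (hij.trans Fin.castSucc_lt_succ.le) le_rfl]

variable (hq : ‖q‖ < 1)
include hq

lemma exists_bound_dlChain (k : Fin (N + 1)) : ∃ K : ℝ, 0 ≤ K ∧
    ∀ (ℓ : MvPolynomial (Fin (N + 1)) ℂ →ₗ[ℂ] ℂ) (d : ℕ) (β : ℝ),
      (∀ v, wt v = d → ‖spec q t v k * ℓ (MM q t M v)‖ ≤ β) →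
      ∀ v, wt v = d → ‖spec q t v 0 * ℓ (dlChain t k (MM q t M v))‖ ≤ K * β := by
  induction k using Fin.induction with
  | zero => exact ⟨1, zero_le_one, fun ℓ d β h v hv => by rw [one_mul]; exact h v hv⟩
  | succ i ih =>
    obtain ⟨K, hK, hK'⟩ := ih
    obtain ⟨L, hL, hL'⟩ := hg.exists_bounds hq N
    refine ⟨K * (2 * L + ‖t‖), by positivity, fun ℓ d β h v hv => ?_⟩
    rw [dlChain_succ, mul_assoc]
    refine hK' (ℓ ∘ₗ dl t i) d ((2 * L + ‖t‖) * β) (fun v hv => ?_) v hv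
    have hβ : 0 ≤ β := (norm_nonneg _).trans (h v hv)
    have h1 := h v hv
    rw [LinearMap.comp_apply]
    by_cases hvi : v i.castSucc = v i.succ
    · rw [dl_MM_of_eq hg hM i hvi, spec_castSucc_of_eq q t v i hvi, mul_assoc, norm_mul]
      nlinarith [mul_le_mul_of_nonneg_left h1 (norm_nonneg t), mul_nonneg hL hβ]
    · have h2 := h (v ∘ adj i) (by rwa [wt_comp])
      have hA : spec q t v i.castSucc * dlA t i (spec q t v) =
          (dlA t i (spec q t v) + t - 1) * spec q t v i.succ := by
        have := sub_ne_zero.2 (hg.spec_ne v i)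
        rw [dlA]
        field_simp
        ring
      rw [spec_comp_adj q t v i hvi, Function.comp, adj_succ] at h2
      rw [dl_MM_of_ne hg hM i hvi, map_add, map_smul, map_smul, smul_eq_mul, smul_eq_mul, mul_add,
        ← mul_assoc, hA, mul_assoc, mul_left_comm (spec q t v i.castSucc)]
      refine (norm_add_le _ _).trans ?_
      rw [norm_mul (dlA t i (spec q t v) + t - 1), norm_mul (dlB _ _ _)]
      have e1 := mul_le_mul (hL' i v).2.1 h1 (norm_nonneg _) hL
      have e2 := mul_le_mul (hL' i (v ∘ adj i)).2.2.1 h2 (norm_nonneg _) hL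
      nlinarith [mul_nonneg (norm_nonneg t) hβ]

variable (x : Fin (N + 1) → ℂ)

lemma exists_bound_dlProd_rot (k : Fin (N + 1)) : ∃ K : ℝ, 0 ≤ K ∧ ∀ (d : ℕ) (β : ℝ),
    (∀ v, wt v = d → ‖eval x (MM q t M v)‖ ≤ β) → ∀ v, wt v = d →
      ‖eval x (dlProd t k (Fin.last N) (MM q t M (rot v)))‖ ≤ K * β := by
  obtain ⟨K, hK, hK'⟩ := exists_bound_dlChain hg hM hq k
  obtain ⟨δ, hδ, hδ'⟩ := hg.exists_pos_le_norm hq (N + 1)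
  set R := ‖x k‖ + max 1 ‖t‖ ^ (N + 1)
  have hR : 0 ≤ R := by positivity
  refine ⟨δ⁻¹ * (K * R), by positivity, fun d β h v hv => ?_⟩
  have h1 := hK' ((aeval x).toLinearMap ∘ₗ cherednik q t k) d (R * β) (fun v hv => ?_) v hv
  · rw [LinearMap.comp_apply, AlgHom.toLinearMap_apply, cherednik, mul_assoc,
      Module.End.mul_apply, Module.End.mul_apply, ← Module.End.mul_apply (dlProd t 0 k),
      dlProd_mul_dlChain hg.t_ne, Module.End.one_apply, ← smul_eq_mul, ← map_smul, ← map_smul,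
      raise_MM hg hM, map_smul, map_smul, smul_eq_mul, norm_mul] at h1
    change _ * ‖eval x _‖ ≤ _ at h1
    have h2 := hδ' (v 0 + 1 : ℕ) (N + 1 - 1 - lp v 0 : ℕ) (by rw [abs_le]; omega) (by omega)
    rw [zpow_natCast, zpow_natCast, pow_succ', mul_assoc] at h2
    rw [mul_assoc, mul_assoc, inv_mul_eq_div, le_div_iff₀' hδ]
    exact (mul_le_mul_of_nonneg_right h2 (norm_nonneg _)).trans h1
  · change ‖spec q t v k * eval x (cherednik q t k (MM q t M v))‖ ≤ _
    rw [spec_mul_eval_cherednik_MM hg hM, norm_mul]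
    exact mul_le_mul ((norm_sub_le _ _).trans (add_le_add_right (norm_spec_le hq t v k) _)) (h v hv)
      (norm_nonneg _) hR

lemma exists_bound_dlProd (k : Fin (N + 1)) : ∃ K : ℝ, 0 ≤ K ∧ ∀ (d : ℕ) (β : ℝ),
    (∀ v, wt v = d → ‖eval x (MM q t M v)‖ ≤ β) → ∀ u, wt u = d + 1 → u k ≠ 0 →
      (∀ m, k < m → u m = 0) → ∀ j ≤ k, (∀ m, j ≤ m → m < k → u m = 0) →
      ‖eval x (dlProd t j k (MM q t M u))‖ ≤ K * β := by
  induction k using Fin.reverseInduction with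
  | last =>
    choose K hK hK' using exists_bound_dlProd_rot hg hM hq x
    refine ⟨∑ k, K k, Finset.sum_nonneg fun k _ => hK k, fun d β h u hu hk _ j _ _ => ?_⟩
    obtain ⟨v, rfl⟩ := exists_eq_rot u hk
    rw [wt_rot, Nat.add_right_cancel_iff] at hu
    refine (hK' j d β h v hu).trans (mul_le_mul_of_nonneg_right ?_
      ((norm_nonneg _).trans (h v hu)))
    exact Finset.single_le_sum (fun k _ => hK k) (Finset.mem_univ j)
  | cast i ih =>
    obtain ⟨K, hK, hK'⟩ := ih
    obtain ⟨L, hL, hL'⟩ := hg.exists_bounds hq N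
    refine ⟨L * (‖t‖ * K + L * K), by positivity, fun d β h u hu hk hk' j hj hj' => ?_⟩
    have hs : u i.succ = 0 := hk' _ Fin.castSucc_lt_succ
    have hne : u i.castSucc ≠ u i.succ := by rwa [hs]
    have hne' : (u ∘ adj i) i.castSucc ≠ (u ∘ adj i) i.succ := by simpa using hne.symm
    have hwt : wt (u ∘ adj i) = d + 1 := by rwa [wt_comp]
    have hnz : (u ∘ adj i) i.succ ≠ 0 := by simpa using hk
    have hz : ∀ m, i.succ < m → (u ∘ adj i) m = 0 := fun m hm => by
      have hm' : i.castSucc < m := Fin.castSucc_lt_succ.trans hm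
      rw [Function.comp, adj_of_ne i hm'.ne' hm.ne', hk' m hm']
    have hz' : ∀ m, j ≤ m → m ≤ i.castSucc → (u ∘ adj i) m = 0 := fun m hm hm' => by
      rcases hm'.eq_or_lt with rfl | hlt
      · simpa using hs
      · rw [Function.comp, adj_of_ne i hlt.ne (hlt.trans Fin.castSucc_lt_succ).ne, hj' m hm hlt]
    have h1 := hK' d β h _ hwt hnz hz j (hj.trans Fin.castSucc_lt_succ.le)
      fun m hm hm' => hz' m hm (Fin.le_castSucc_iff.2 hm')
    have h2 := hK' d β h _ hwt hnz hz i.succ le_rfl fun m hm hm' => absurd hm hm'.not_ge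
    rw [dlProd_self, Module.End.one_apply] at h2
    have hb := hg.dlB_ne_zero hne
    have ht := hg.t_ne
    have key : eval x (dlProd t j i.castSucc (MM q t M u)) = (dlB t i (spec q t u))⁻¹ *
        (t * eval x (dlProd t j i.succ (MM q t M (u ∘ adj i))) -
          (dlA t i (spec q t (u ∘ adj i)) + t - 1) * eval x (MM q t M (u ∘ adj i))) := by
      rw [dlProd_succ t hj, Module.End.mul_apply, dlInv_MM_of_ne hg hM i hne', comp_adj_comp_adj,
        map_add, map_smul, map_smul, dlProd_MM_of_zero hg hM hj hz', map_add, smul_eval, smul_eval]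
      field_simp
      ring
    rw [key, norm_mul]
    have hβ : 0 ≤ K * β := (norm_nonneg _).trans h2
    have e1 := mul_le_mul_of_nonneg_left h1 (norm_nonneg t)
    have e2 := mul_le_mul (hL' i (u ∘ adj i)).2.1 h2 (norm_nonneg _) hL
    rw [← norm_mul] at e1 e2
    rw [mul_assoc]
    refine mul_le_mul ((hL' i u).2.2.2 hne) ((norm_sub_le _ _).trans ?_) (norm_nonneg _) hL
    linarith

/-- At a fixed point the `𝖬_u` grow at most geometrically in `|u|`. -/
lemma exists_bound_MM : ∃ C K : ℝ, 0 ≤ C ∧ 0 ≤ K ∧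
    ∀ u, ‖eval x (MM q t M u)‖ ≤ C * K ^ wt u := by
  choose K hK hK' using exists_bound_dlProd hg hM hq x
  have hK0 : 0 ≤ ∑ k, K k := Finset.sum_nonneg fun k _ => hK k
  refine ⟨‖eval x (MM q t M 0)‖, ∑ k, K k, norm_nonneg _, hK0, fun u => ?_⟩
  induction hd : wt u generalizing u with
  | zero =>
    have hu : u = 0 := by
      funext k; simpa using (Finset.sum_eq_zero_iff.1 hd) k (Finset.mem_univ _)
    simp [hu]
  | succ d ih =>
    obtain ⟨k, hk, hk'⟩ := exists_last_ne_zero (u := u) (by omega)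
    have h := hK' k d _ ih u hd hk hk' k le_rfl fun m hm hm' => absurd hm hm'.not_ge
    rw [dlProd_self, Module.End.one_apply] at h
    refine h.trans ?_
    rw [pow_succ, mul_comm (K k), ← mul_assoc _ _ (∑ k, K k)]
    exact mul_le_mul_of_nonneg_left
      (Finset.single_le_sum (fun k _ => hK k) (Finset.mem_univ k))
      (mul_nonneg (norm_nonneg (eval x (MM q t M 0))) (pow_nonneg hK0 _))

end Growth

/-! ### The series `∑ a^k ∏_{j<k} (x - y q^j) / (1 - q^{j+1})` -/

/-- The `q`-binomial series, the expansion of `(a y; q)_∞ / (a x; q)_∞` in powers of `a`. -/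
def qser (q x y : ℂ) : PowerSeries ℂ :=
  PowerSeries.mk fun k => ∏ j ∈ Finset.range k, (x - y * q ^ j) / (1 - q ^ (j + 1))

lemma coeff_qser (q x y : ℂ) (k : ℕ) : PowerSeries.coeff k (qser q x y) =
    ∏ j ∈ Finset.range k, (x - y * q ^ j) / (1 - q ^ (j + 1)) := PowerSeries.coeff_mk _ _

lemma one_sub_pow_ne_zero {q : ℂ} (hq : ‖q‖ < 1) (j : ℕ) : 1 - q ^ (j + 1) ≠ 0 := by
  intro h
  have h1 := congrArg norm (sub_eq_zero.1 h)
  rw [norm_one, norm_pow] at h1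
  exact (pow_lt_one₀ (norm_nonneg _) hq j.succ_ne_zero).ne h1.symm

/-- The functional equation `(1 - a x) P(a) = (1 - a y) P(q a)`. -/
def QDifference (q x y : ℂ) (P : PowerSeries ℂ) : Prop :=
  (1 - PowerSeries.C x * PowerSeries.X) * P =
    (1 - PowerSeries.C y * PowerSeries.X) * PowerSeries.rescale q P

lemma qDifference_iff {q x y : ℂ} {P : PowerSeries ℂ} : QDifference q x y P ↔
    ∀ k, (1 - q ^ (k + 1)) * PowerSeries.coeff (k + 1) P =
      (x - y * q ^ k) * PowerSeries.coeff k P := by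
  rw [QDifference, PowerSeries.ext_iff]
  have h (k : ℕ) (z : ℂ) (Q : PowerSeries ℂ) :
      PowerSeries.coeff (k + 1) ((1 - PowerSeries.C z * PowerSeries.X) * Q) =
        PowerSeries.coeff (k + 1) Q - z * PowerSeries.coeff k Q := by
    rw [sub_mul, one_mul, map_sub, mul_assoc, PowerSeries.coeff_C_mul,
      PowerSeries.coeff_succ_X_mul]
  constructor
  · intro H k
    have := H (k + 1)
    rw [h, h, PowerSeries.coeff_rescale, PowerSeries.coeff_rescale] at this
    linear_combination this
  · rintro H (_ | k)
    · have : PowerSeries.constantCoeff (PowerSeries.rescale q P) =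
          PowerSeries.constantCoeff P := by
        rw [← PowerSeries.coeff_zero_eq_constantCoeff_apply, PowerSeries.coeff_rescale, pow_zero,
          one_mul, PowerSeries.coeff_zero_eq_constantCoeff_apply]
      simp [this]
    · rw [h, h, PowerSeries.coeff_rescale, PowerSeries.coeff_rescale]
      linear_combination H k

lemma qDifference_qser {q : ℂ} (hq : ‖q‖ < 1) (x y : ℂ) : QDifference q x y (qser q x y) := by
  refine qDifference_iff.2 fun k => ?_
  have := one_sub_pow_ne_zero hq k
  rw [coeff_qser, coeff_qser, Finset.prod_range_succ]
  field_simp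

lemma QDifference.eq_qser {q x y : ℂ} (hq : ‖q‖ < 1) {P : PowerSeries ℂ}
    (h : QDifference q x y P) (h0 : PowerSeries.coeff 0 P = 1) : P = qser q x y := by
  ext k
  induction k with
  | zero => rw [h0, coeff_qser, Finset.prod_range_zero]
  | succ k ih =>
    refine mul_left_cancel₀ (one_sub_pow_ne_zero hq k) ?_
    rw [qDifference_iff.1 h, qDifference_iff.1 (qDifference_qser hq x y), ih]

lemma qser_mul_qser {q : ℂ} (hq : ‖q‖ < 1) (x y z : ℂ) :
    qser q x y * qser q y z = qser q x z := by
  refine QDifference.eq_qser hq ?_ ?_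
  · have h1 := qDifference_qser hq x y
    have h2 := qDifference_qser hq y z
    rw [QDifference] at h1 h2 ⊢
    rw [map_mul, ← mul_assoc, h1, mul_right_comm, h2]
    ring
  · simp [PowerSeries.coeff_mul, coeff_qser]

lemma prod_qser_comp {ι : Type*} [Fintype ι] {q : ℂ} (hq : ‖q‖ < 1) (x y : ι → ℂ)
    (π : Equiv.Perm ι) : ∏ i, qser q (x (π i)) (y i) = ∏ i, qser q (x i) (y i) := by
  have h (z : ι → ℂ) : ∏ i, qser q (z i) (y i) =
      (∏ i, qser q (z i) 0) * ∏ i, qser q 0 (y i) := by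
    rw [← Finset.prod_mul_distrib]
    exact Finset.prod_congr rfl fun i _ => (qser_mul_qser hq _ _ _).symm
  rw [h x, h fun i => x (π i), Equiv.prod_comp π fun i => qser q (x i) 0]

/-! #### Top coefficients -/

/-- `P` is a polynomial of degree at most `d` whose coefficient in degree `d` is `c`. -/
def HasTop (P : PowerSeries ℂ) (d : ℕ) (c : ℂ) : Prop :=
  (∀ k, d < k → PowerSeries.coeff k P = 0) ∧ PowerSeries.coeff d P = c

lemma HasTop.mul {P Q : PowerSeries ℂ} {d e : ℕ} {b c : ℂ} (hP : HasTop P d b)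
    (hQ : HasTop Q e c) : HasTop (P * Q) (d + e) (b * c) := by
  constructor
  · intro k hk
    rw [PowerSeries.coeff_mul]
    refine Finset.sum_eq_zero fun ij hij => ?_
    rw [Finset.HasAntidiagonal.mem_antidiagonal] at hij
    rcases lt_or_ge d ij.1 with h | h
    · rw [hP.1 _ h, zero_mul]
    · rw [hQ.1 _ (by omega), mul_zero]
  · rw [PowerSeries.coeff_mul, Finset.sum_eq_single (d, e), hP.2, hQ.2]
    · rintro ⟨i, j⟩ hij hne
      rw [Finset.HasAntidiagonal.mem_antidiagonal] at hij
      rcases lt_trichotomy d i with h | h | h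
      · rw [hP.1 _ h, zero_mul]
      · exact absurd (Prod.ext h.symm (by dsimp only at hij ⊢; omega)) hne
      · rw [hQ.1 _ (by dsimp only at hij ⊢; omega), mul_zero]
    · simp

lemma HasTop.prod {ι : Type*} (s : Finset ι) {P : ι → PowerSeries ℂ} {d : ι → ℕ} {c : ι → ℂ}
    (h : ∀ i, HasTop (P i) (d i) (c i)) :
    HasTop (∏ i ∈ s, P i) (∑ i ∈ s, d i) (∏ i ∈ s, c i) := by
  induction s using Finset.cons_induction with
  | empty =>
    constructor
    · intro k hk
      rw [Finset.prod_empty, PowerSeries.coeff_one, if_neg (by simpa using hk.ne')]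
    · simp
  | cons i s hi ih =>
    rw [Finset.prod_cons, Finset.sum_cons, Finset.prod_cons]
    exact (h i).mul ih

lemma hasTop_qser {q : ℂ} (hq : ‖q‖ < 1) (y : ℂ) (d : ℕ) :
    HasTop (qser q (q ^ d * y) y) d ((-1) ^ d * y ^ d * q ^ d.choose 2) := by
  constructor
  · intro k hk
    rw [coeff_qser]
    exact Finset.prod_eq_zero (Finset.mem_range.2 hk) (by ring)
  · have h1 : ∏ j ∈ Finset.range d, (1 - q ^ (d - j)) =
        ∏ j ∈ Finset.range d, (1 - q ^ (j + 1)) := by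
      rw [← Finset.prod_range_reflect]
      refine Finset.prod_congr rfl fun j hj => ?_
      rw [Finset.mem_range] at hj
      rw [show d - (d - 1 - j) = j + 1 by omega]
    have h2 : ∏ j ∈ Finset.range d, (q ^ d * y - y * q ^ j) =
        ∏ j ∈ Finset.range d, (-1 * y * q ^ j * (1 - q ^ (d - j))) := by
      refine Finset.prod_congr rfl fun j hj => ?_
      rw [Finset.mem_range] at hj
      have : q ^ d = q ^ j * q ^ (d - j) := by rw [← pow_add]; congr 1; omega
      rw [this]
      ring
    rw [coeff_qser, Finset.prod_div_distrib, div_eq_iff (Finset.prod_ne_zero_iff.2 fun j _ =>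
      one_sub_pow_ne_zero hq j), h2, Finset.prod_mul_distrib, h1, Finset.prod_mul_distrib,
      Finset.prod_mul_distrib, Finset.prod_const, Finset.prod_const, Finset.card_range,
      Finset.prod_pow_eq_pow_sum, Finset.sum_range_id, Nat.choose_two_right]

/-! #### Dependence on `x` -/

/-- `f` is a polynomial function of total degree at most `d`. -/
def IsPolyFun {n : ℕ} (d : ℕ) (f : (Fin n → ℂ) → ℂ) : Prop :=
  ∃ p : MvPolynomial (Fin n) ℂ, p.totalDegree ≤ d ∧ ∀ x, eval x p = f x

namespace IsPolyFun

variable {n : ℕ}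

lemma const (d : ℕ) (c : ℂ) : IsPolyFun d fun _ : Fin n → ℂ => c :=
  ⟨C c, by simp, by simp⟩

lemma mul {d e : ℕ} {f g : (Fin n → ℂ) → ℂ} (hf : IsPolyFun d f) (hg : IsPolyFun e g) :
    IsPolyFun (d + e) fun x => f x * g x := by
  obtain ⟨p, hp, hp'⟩ := hf
  obtain ⟨r, hr, hr'⟩ := hg
  exact ⟨p * r, (totalDegree_mul p r).trans (add_le_add hp hr), fun x => by
    rw [map_mul, hp', hr']⟩

lemma sum {ι : Type*} (s : Finset ι) {d : ℕ} {f : ι → (Fin n → ℂ) → ℂ}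
    (hf : ∀ i ∈ s, IsPolyFun d (f i)) : IsPolyFun d fun x => ∑ i ∈ s, f i x := by
  choose! p hp hp' using hf
  refine ⟨∑ i ∈ s, p i, totalDegree_finsetSum_le hp, fun x => ?_⟩
  rw [map_sum]
  exact Finset.sum_congr rfl fun i hi => hp' i hi x

lemma eq_of_eval_spec {q t : ℂ} (hg : IsGeneric q t) {d : ℕ} {f g : (Fin n → ℂ) → ℂ}
    (hf : IsPolyFun d f) (hg' : IsPolyFun d g)
    (h : ∀ w, wt w ≤ d → f (spec q t w) = g (spec q t w)) : f = g := by
  obtain ⟨p, hp, hp'⟩ := hf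
  obtain ⟨r, hr, hr'⟩ := hg'
  funext x
  rw [← hp', ← hr', LRW.eq_of_eval_spec hg hp hr fun w hw => by rw [hp', hr', h w hw]]

end IsPolyFun

lemma isPolyFun_coeff_qser {n : ℕ} (q y : ℂ) (i : Fin n) (k : ℕ) :
    IsPolyFun k fun x => PowerSeries.coeff k (qser q (x i) y) := by
  simp_rw [coeff_qser]
  induction k with
  | zero => simpa using IsPolyFun.const 0 1
  | succ k ih =>
    simp_rw [Finset.prod_range_succ]
    refine ih.mul ⟨C (1 - q ^ (k + 1))⁻¹ * (X i - C (y * q ^ k)), ?_, fun x => ?_⟩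
    · refine (totalDegree_mul _ _).trans ?_
      rw [totalDegree_C, zero_add]
      exact (totalDegree_sub_C_le _ _).trans (totalDegree_X i).le
    · simp [div_eq_inv_mul]

lemma isPolyFun_coeff_prod {n : ℕ} {ι : Type*} (s : Finset ι)
    {P : ι → (Fin n → ℂ) → PowerSeries ℂ}
    (h : ∀ i k, IsPolyFun k fun x => PowerSeries.coeff k (P i x)) (k : ℕ) :
    IsPolyFun k fun x => PowerSeries.coeff k (∏ i ∈ s, P i x) := by
  induction s using Finset.cons_induction generalizing k with
  | empty => simpa using IsPolyFun.const k _
  | cons i s hi ih =>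
    simp_rw [Finset.prod_cons, PowerSeries.coeff_mul]
    refine IsPolyFun.sum _ fun ij hij => ?_
    rw [← Finset.HasAntidiagonal.mem_antidiagonal.1 hij]
    exact (h i ij.1).mul (ih ij.2)

/-! #### Values -/

/-- The power series `P` converges absolutely at `a`, with sum `s`. -/
def SumsTo (P : PowerSeries ℂ) (a s : ℂ) : Prop :=
  Summable (fun k => ‖PowerSeries.coeff k P * a ^ k‖) ∧
    ∑' k, PowerSeries.coeff k P * a ^ k = s

lemma SumsTo.mul {P Q : PowerSeries ℂ} {a s r : ℂ} (hP : SumsTo P a s) (hQ : SumsTo Q a r) :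
    SumsTo (P * Q) a (s * r) := by
  have h (k : ℕ) : PowerSeries.coeff k (P * Q) * a ^ k =
      ∑ ij ∈ Finset.HasAntidiagonal.antidiagonal k,
        (PowerSeries.coeff ij.1 P * a ^ ij.1) * (PowerSeries.coeff ij.2 Q * a ^ ij.2) := by
    rw [PowerSeries.coeff_mul, Finset.sum_mul]
    refine Finset.sum_congr rfl fun ij hij => ?_
    rw [← Finset.HasAntidiagonal.mem_antidiagonal.1 hij]
    ring
  constructor
  · exact (summable_norm_sum_mul_antidiagonal_of_summable_norm hP.1 hQ.1).congr fun k => by rw [h]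
  · rw [tsum_congr h, ← hP.2, ← hQ.2]
    exact (tsum_mul_tsum_eq_tsum_sum_antidiagonal_of_summable_norm hP.1 hQ.1).symm

lemma SumsTo.prod {ι : Type*} (s : Finset ι) {P : ι → PowerSeries ℂ} {a : ℂ} {r : ι → ℂ}
    (h : ∀ i, SumsTo (P i) a (r i)) : SumsTo (∏ i ∈ s, P i) a (∏ i ∈ s, r i) := by
  induction s using Finset.cons_induction with
  | empty =>
    have h0 (k : ℕ) (hk : k ≠ 0) : PowerSeries.coeff k (1 : PowerSeries ℂ) * a ^ k = 0 := by
      rw [PowerSeries.coeff_one, if_neg hk, zero_mul]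
    rw [Finset.prod_empty, Finset.prod_empty]
    constructor
    · refine summable_of_ne_finset_zero (s := {0}) fun k hk => ?_
      rw [h0 k (by simpa using hk), norm_zero]
    · rw [tsum_eq_single 0 h0]
      simp
  | cons i s hi ih =>
    rw [Finset.prod_cons, Finset.prod_cons]
    exact (h i).mul ih

section Value

variable {q : ℂ} (hq : ‖q‖ < 1)
include hq

lemma norm_coeff_qser_le (x y : ℂ) (k : ℕ) :
    ‖PowerSeries.coeff k (qser q x y)‖ ≤ ((‖x‖ + ‖y‖) / (1 - ‖q‖)) ^ k := by
  rw [coeff_qser, norm_prod, ← Finset.card_range k, ← Finset.prod_const, Finset.card_range]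
  refine Finset.prod_le_prod (fun _ _ => norm_nonneg _) fun j _ => ?_
  rw [norm_div]
  have h1 : ‖q ^ j‖ ≤ 1 := by rw [norm_pow]; exact pow_le_one₀ (norm_nonneg _) hq.le
  refine div_le_div₀ (by positivity) ((norm_sub_le _ _).trans ?_) (sub_pos.2 hq) ?_
  · rw [norm_mul]
    gcongr
    exact mul_le_of_le_one_right (norm_nonneg _) h1
  · have h2 : ‖q ^ (j + 1)‖ ≤ ‖q‖ := by
      rw [pow_succ, norm_mul]
      exact mul_le_of_le_one_left (norm_nonneg _) h1
    have := norm_sub_norm_le 1 (q ^ (j + 1))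
    rw [norm_one] at this
    linarith

lemma tendsto_qpochInf (z : ℂ) : Filter.Tendsto
    (fun N => ∏ m ∈ Finset.range N, (1 - z * q ^ m)) Filter.atTop (nhds (qpochInf z q)) := by
  have : Multipliable fun m : ℕ => 1 + -(z * q ^ m) := by
    refine multipliable_one_add_of_summable ?_
    simp_rw [norm_neg, norm_mul, norm_pow]
    exact (summable_geometric_of_lt_one (norm_nonneg _) hq).mul_left _
  simpa [sub_eq_add_neg, qpochInf] using this.hasProd.tendsto_prod_nat

lemma norm_qser_term_le {x y a : ℂ} (N k : ℕ) :
    ‖PowerSeries.coeff k (qser q x y) * (q ^ N * a) ^ k‖ ≤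
      ((‖x‖ + ‖y‖) / (1 - ‖q‖) * ‖a‖) ^ k := by
  have h : 0 ≤ (‖x‖ + ‖y‖) / (1 - ‖q‖) := div_nonneg (by positivity) (sub_pos.2 hq).le
  rw [norm_mul, mul_pow, mul_pow, norm_mul, ← one_mul (‖a‖ ^ k), norm_pow a]
  refine mul_le_mul (norm_coeff_qser_le hq x y k) ?_ (by positivity) (by positivity)
  gcongr
  rw [norm_pow, norm_pow]
  exact pow_le_one₀ (by positivity) (pow_le_one₀ (norm_nonneg _) hq.le)

variable {x y a : ℂ} (ha : (‖x‖ + ‖y‖) / (1 - ‖q‖) * ‖a‖ < 1)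
include ha

lemma summable_norm_qser (N : ℕ) :
    Summable fun k => ‖PowerSeries.coeff k (qser q x y) * (q ^ N * a) ^ k‖ :=
  .of_nonneg_of_le (fun _ => norm_nonneg _) (norm_qser_term_le hq N)
    (summable_geometric_of_lt_one
      (mul_nonneg (div_nonneg (by positivity) (sub_pos.2 hq).le) (norm_nonneg _)) ha)

lemma qpochInf_mul_tsum : qpochInf (a * x) q * ∑' k, PowerSeries.coeff k (qser q x y) * a ^ k =
    qpochInf (a * y) q := by
  set f : ℕ → ℂ := fun N => ∑' k, PowerSeries.coeff k (qser q x y) * (q ^ N * a) ^ k with hf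
  have hsum (N : ℕ) : Summable fun k => PowerSeries.coeff k (qser q x y) * (q ^ N * a) ^ k :=
    (summable_norm_qser hq ha N).of_norm
  have hstep (N : ℕ) : (1 - a * x * q ^ N) * f N = (1 - a * y * q ^ N) * f (N + 1) := by
    have h1 := (hsum N).tsum_eq_zero_add
    have h2 := (hsum (N + 1)).tsum_eq_zero_add
    have h3 : ∀ M, Summable fun k => PowerSeries.coeff k (qser q x y) * (q ^ M * a) ^ k := hsum
    have h4 : ∑' k, PowerSeries.coeff (k + 1) (qser q x y) * (q ^ N * a) ^ (k + 1) -
        ∑' k, PowerSeries.coeff (k + 1) (qser q x y) * (q ^ (N + 1) * a) ^ (k + 1) =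
        a * x * q ^ N * f N - a * y * q ^ N * f (N + 1) := by
      rw [hf, ← tsum_mul_left, ← tsum_mul_left, ← ((summable_nat_add_iff 1).2 (hsum N)).tsum_sub
        ((summable_nat_add_iff 1).2 (hsum (N + 1))),
        ← ((hsum N).mul_left _).tsum_sub ((hsum (N + 1)).mul_left _)]
      refine tsum_congr fun k => ?_
      have := qDifference_iff.1 (qDifference_qser hq x y) k
      rw [pow_succ q N, show q ^ N * q * a = q * (q ^ N * a) by ring, mul_pow q, mul_pow q]
      linear_combination (q ^ N * a) ^ (k + 1) * this
    rw [pow_zero] at h1 h2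
    linear_combination h1 - h2 + h4
  have hiter (N : ℕ) : (∏ m ∈ Finset.range N, (1 - a * x * q ^ m)) * f 0 =
      (∏ m ∈ Finset.range N, (1 - a * y * q ^ m)) * f N := by
    induction N with
    | zero => rfl
    | succ N ih =>
      rw [Finset.prod_range_succ, Finset.prod_range_succ, mul_right_comm, ih, mul_right_comm,
        mul_assoc, hstep, ← mul_assoc]
  have hlim : Filter.Tendsto f Filter.atTop (nhds 1) := by
    have h1 : ∑' k, PowerSeries.coeff k (qser q x y) * (0 : ℂ) ^ k = 1 := by
      rw [tsum_eq_single 0 fun k hk => by rw [zero_pow hk, mul_zero], coeff_qser]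
      simp
    rw [← h1]
    refine tendsto_tsum_of_dominated_convergence (summable_geometric_of_lt_one
      (mul_nonneg (div_nonneg (by positivity) (sub_pos.2 hq).le) (norm_nonneg _)) ha)
      (fun k => ?_) (.of_forall fun N k => norm_qser_term_le hq N k)
    have h2 : Filter.Tendsto (fun N : ℕ => q ^ N * a) Filter.atTop (nhds 0) := by
      simpa using (tendsto_pow_atTop_nhds_zero_of_norm_lt_one hq).mul_const a
    exact (h2.pow k).const_mul _
  have h0 : f 0 = ∑' k, PowerSeries.coeff k (qser q x y) * a ^ k := by simp [hf]
  rw [← h0]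
  refine tendsto_nhds_unique ((tendsto_qpochInf hq (a * x)).mul_const (f 0)) ?_
  simp_rw [hiter]
  simpa using (tendsto_qpochInf hq (a * y)).mul hlim

lemma qpochInf_ne_zero : qpochInf (a * x) q ≠ 0 := by
  have h : (‖x‖ + ‖(0 : ℂ)‖) / (1 - ‖q‖) * ‖a‖ < 1 := by
    refine lt_of_le_of_lt ?_ ha
    rw [norm_zero, add_zero]
    have := sub_pos.2 hq
    gcongr
    exact le_add_of_nonneg_right (norm_nonneg y)
  have h1 := qpochInf_mul_tsum hq h
  intro h0
  rw [h0, zero_mul, mul_zero] at h1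
  simp [qpochInf] at h1

lemma sumsTo_qser : SumsTo (qser q x y) a (qpochInf (a * y) q / qpochInf (a * x) q) := by
  refine ⟨by simpa using summable_norm_qser hq ha 0, ?_⟩
  rw [eq_div_iff (qpochInf_ne_zero hq ha), mul_comm, qpochInf_mul_tsum hq ha]

end Value

/-! ### The homogeneous components of the `q`-binomial theorem -/

lemma choose_two_add (a b : ℕ) : (a + b).choose 2 = a.choose 2 + b.choose 2 + a * b := by
  induction b with
  | zero => simp
  | succ b ih =>
    rw [← add_assoc, Nat.choose_succ_succ' (a + b), Nat.choose_succ_succ' b, ih,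
      Nat.choose_one_right, Nat.choose_one_right]
    ring

section Components

variable {q t : ℂ}

lemma hasTop_X_pow (k : ℕ) : HasTop (PowerSeries.X ^ k) k 1 :=
  ⟨fun j hj => by rw [PowerSeries.coeff_X_pow, if_neg hj.ne'], by rw [PowerSeries.coeff_X_pow_self]⟩

lemma Contained.hasTop {n : ℕ} (hq : ‖q‖ < 1) {v w : Fin n → ℕ} (h : Contained v w) :
    ∃ c, sigma q t w = sigma q t v * c ∧
      HasTop (PowerSeries.X ^ wt v * ∏ i, qser q (spec q t w i) (spec q t v i)) (wt w) c := by
  obtain ⟨π, hπ⟩ := h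
  obtain ⟨d, hd⟩ : ∃ d : Fin n → ℕ, ∀ i, w (π i) = v i + d i :=
    ⟨fun i => w (π i) - v i, fun i => (Nat.add_sub_cancel' (hπ i).2).symm⟩
  refine ⟨∏ i, ((-1) ^ d i * spec q t v i ^ d i * q ^ (d i).choose 2), ?_, ?_⟩
  · rw [sigma, sigma, ← Equiv.prod_comp π, ← Finset.prod_mul_distrib]
    refine Finset.prod_congr rfl fun i _ => ?_
    rw [(hπ i).1, hd, choose_two_add, spec]
    ring
  · have hwt : wt w = wt v + ∑ i, d i := by
      rw [wt, wt, ← Finset.sum_add_distrib, ← Equiv.sum_comp π]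
      exact Finset.sum_congr rfl fun i _ => hd i
    have hs (i : Fin n) : spec q t w (π i) = q ^ d i * spec q t v i := by
      rw [spec, spec, hd, (hπ i).1]
      ring
    rw [hwt, ← one_mul (∏ i, (_ : ℂ)), ← prod_qser_comp hq (spec q t w) (spec q t v) π]
    simp_rw [hs]
    exact (hasTop_X_pow _).mul (HasTop.prod _ fun i => hasTop_qser hq _ _)

variable (hg : IsGeneric q t) (hq : ‖q‖ < 1) {N : ℕ}
  {M : (Fin (N + 1) → ℕ) → MvPolynomial (Fin (N + 1)) ℂ} (hM : IsInterpFamily q t M)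
include hM

lemma eval_MM_of_ne {u w : Fin (N + 1) → ℕ} (hw : wt w ≤ wt u) (h : w ≠ u) :
    eval (spec q t w) (MM q t M u) = 0 := by
  rw [MM_eq, smul_eval, (hM u).2.2 w hw h, mul_zero]

include hg hq

lemma sum_qbin_mul_eval_MM (v : Fin (N + 1) → ℕ) (m : ℕ) (x : Fin (N + 1) → ℂ) :
    ∑ u ∈ Finset.piAntidiag Finset.univ m, qbin q t M u v * eval x (MM q t M u) =
      eval x (MM q t M v) *
        PowerSeries.coeff m (PowerSeries.X ^ wt v * ∏ i, qser q (x i) (spec q t v i)) := by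
  have hmem {u : Fin (N + 1) → ℕ} : u ∈ Finset.piAntidiag Finset.univ m ↔ wt u = m := by
    simp [Finset.mem_piAntidiag, wt]
  have hdeg (u : Fin (N + 1) → ℕ) : (MM q t M u).totalDegree ≤ wt u := by
    rw [MM_eq]
    exact (totalDegree_smul_le _ _).trans (hM u).1
  refine congrFun (IsPolyFun.eq_of_eval_spec hg (d := m)
    (f := fun x => ∑ u ∈ Finset.piAntidiag Finset.univ m, qbin q t M u v * eval x (MM q t M u))
    (g := fun x => eval x (MM q t M v) *
      PowerSeries.coeff m (PowerSeries.X ^ wt v * ∏ i, qser q (x i) (spec q t v i)))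
    ?_ ?_ fun w hw => ?_) x
  · refine IsPolyFun.sum _ fun u hu => ?_
    rw [← zero_add m, ← hmem.1 hu]
    exact (IsPolyFun.const 0 _).mul ⟨_, hdeg u, fun _ => rfl⟩
  · simp_rw [PowerSeries.coeff_X_pow_mul']
    split_ifs with h
    · have := IsPolyFun.mul (f := fun x => eval x (MM q t M v)) ⟨_, hdeg v, fun _ => rfl⟩
        (isPolyFun_coeff_prod Finset.univ
          (fun i k => isPolyFun_coeff_qser q (spec q t v i) i k) (m - wt v))
      rwa [Nat.add_sub_cancel' h] at this
    · simpa using IsPolyFun.const m 0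
  · by_cases hc : Contained v w
    · obtain ⟨c, hc1, hc2⟩ := hc.hasTop (t := t) hq
      rcases hw.eq_or_lt with rfl | hlt
      · rw [hc2.2, Finset.sum_eq_single w (fun u hu huw => by
            rw [eval_MM_of_ne hM (hmem.1 hu).ge huw.symm, mul_zero])
          fun h => absurd (hmem.2 rfl) h, qbin, eval_MM_self hg hM, eval_MM_self hg hM, hc1]
        have := hg.sigma_ne_zero v
        field_simp
      · rw [hc2.1 m hlt, mul_zero]
        refine Finset.sum_eq_zero fun u hu => ?_
        have hu' := hmem.1 hu
        rw [eval_MM_of_ne hM (by omega) (by rintro rfl; omega), mul_zero]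
    · have h0 : eval (spec q t w) (MM q t M v) = 0 := by
        rw [MM_eq, smul_eval, eval_spec_M_eq_zero hg hM hc, mul_zero]
      rw [h0, zero_mul]
      refine Finset.sum_eq_zero fun u hu => ?_
      by_cases huw : w = u
      · rw [qbin, ← huw, h0, zero_div, zero_mul]
      · rw [eval_MM_of_ne hM (hw.trans (hmem.1 hu).ge) huw, mul_zero]

end Components

/-! ### Summation over all compositions -/

section Summation

lemma exists_bound_eval {n : ℕ} (p : MvPolynomial (Fin n) ℂ) {R : ℝ} (hR : 0 ≤ R) :
    ∃ B, ∀ x : Fin n → ℂ, (∀ i, ‖x i‖ ≤ R) → ‖eval x p‖ ≤ B := by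
  obtain ⟨B, hB⟩ := (isCompact_closedBall (0 : Fin n → ℂ) R).exists_bound_of_continuousOn
    (MvPolynomial.continuous_eval p).continuousOn
  exact ⟨B, fun x hx => hB x (mem_closedBall_zero_iff.2 ((pi_norm_le_iff_of_nonneg hR).2 hx))⟩

lemma summable_pow_wt {n : ℕ} {r : ℝ} (h0 : 0 ≤ r) (h1 : r < 1) :
    Summable fun u : Fin n → ℕ => r ^ wt u := by
  refine summable_of_sum_le (c := ∏ _i : Fin n, (1 - r)⁻¹) (fun u => pow_nonneg h0 _) fun s => ?_
  have hs : s ⊆ Fintype.piFinset fun _ => Finset.range (s.sup wt + 1) := fun u hu => by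
    refine Fintype.mem_piFinset.2 fun i => Finset.mem_range.2 (Nat.lt_succ_of_le ?_)
    exact (Finset.single_le_sum (fun _ _ => Nat.zero_le _) (Finset.mem_univ i)).trans
      (Finset.le_sup (f := wt) hu)
  refine (Finset.sum_le_sum_of_subset_of_nonneg hs fun u _ _ => pow_nonneg h0 _).trans ?_
  simp_rw [wt, ← Finset.prod_pow_eq_pow_sum]
  rw [← Finset.prod_univ_sum (fun _ => Finset.range (s.sup wt + 1)) fun _ j => r ^ j]
  refine Finset.prod_le_prod (fun _ _ => Finset.sum_nonneg fun _ _ => pow_nonneg h0 _)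
    fun _ _ => ?_
  rw [← tsum_geometric_of_lt_one h0 h1]
  exact (summable_geometric_of_lt_one h0 h1).sum_le_tsum _ fun _ _ => pow_nonneg h0 _

lemma tsum_eq_tsum_piAntidiag {n : ℕ} {f : (Fin n → ℕ) → ℂ} (hf : Summable f) :
    ∑' u, f u = ∑' m, ∑ u ∈ Finset.piAntidiag Finset.univ m, f u := by
  rw [← (hf.hasSum.tsum_fiberwise wt).tsum_eq]
  refine tsum_congr fun m => ?_
  rw [← Finset.tsum_subtype', show wt ⁻¹' {m} = ↑(Finset.piAntidiag (Finset.univ : Finset (Fin n)) m)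
    by ext u; simp [wt]]

lemma sumsTo_X_pow (a : ℂ) (k : ℕ) : SumsTo (PowerSeries.X ^ k) a (a ^ k) := by
  have h (j : ℕ) (hj : j ≠ k) : PowerSeries.coeff j (PowerSeries.X ^ k : PowerSeries ℂ) * a ^ j = 0 := by
    rw [PowerSeries.coeff_X_pow, if_neg hj, zero_mul]
  constructor
  · refine summable_of_ne_finset_zero (s := {k}) fun j hj => ?_
    rw [h j (by simpa using hj), norm_zero]
  · rw [tsum_eq_single k h, PowerSeries.coeff_X_pow_self, one_mul]

variable {q t : ℂ} (hg : IsGeneric q t) (hq : ‖q‖ < 1) {N : ℕ}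
  {M : (Fin (N + 1) → ℕ) → MvPolynomial (Fin (N + 1)) ℂ} (hM : IsInterpFamily q t M)
include hg hq hM

lemma exists_summable (v : Fin (N + 1) → ℕ) (x : Fin (N + 1) → ℂ) : ∃ K : ℝ, 0 ≤ K ∧
    ∀ a : ℂ, K * ‖a‖ < 1 → Summable fun u : Fin (N + 1) → ℕ =>
      ‖a ^ wt u * qbin q t M u v * eval x (MM q t M u)‖ := by
  obtain ⟨C, K, hC, hK, h⟩ := exists_bound_MM hg hM hq x
  obtain ⟨B, hB⟩ := exists_bound_eval (MM q t M v)
    (show (0 : ℝ) ≤ max 1 ‖t‖ ^ (N + 1) by positivity)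
  refine ⟨K, hK, fun a ha => .of_nonneg_of_le (fun _ => norm_nonneg _) (fun u => ?_)
    ((summable_pow_wt (mul_nonneg hK (norm_nonneg a)) ha).mul_left
      (B / ‖eval (spec q t v) (MM q t M v)‖ * C))⟩
  have hb : ‖qbin q t M u v‖ ≤ B / ‖eval (spec q t v) (MM q t M v)‖ := by
    rw [qbin, norm_div]
    gcongr
    exact hB _ (norm_spec_le hq t u)
  rw [norm_mul, norm_mul, norm_pow]
  calc _ ≤ ‖a‖ ^ wt u * (B / ‖eval (spec q t v) (MM q t M v)‖) * (C * K ^ wt u) := by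
        gcongr
        · exact mul_nonneg (by positivity) ((norm_nonneg _).trans hb)
        · exact h u
    _ = _ := by ring

lemma tsum_qbin_mul_eval_MM (v : Fin (N + 1) → ℕ) (x : Fin (N + 1) → ℂ) {a : ℂ}
    (hs : Summable fun u : Fin (N + 1) → ℕ =>
      ‖a ^ wt u * qbin q t M u v * eval x (MM q t M u)‖)
    (ha : ∀ i, (‖x i‖ + ‖spec q t v i‖) / (1 - ‖q‖) * ‖a‖ < 1) :
    ∑' u : Fin (N + 1) → ℕ, a ^ wt u * qbin q t M u v * eval x (MM q t M u) =
      a ^ wt v * eval x (MM q t M v) *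
        ∏ i, qpochInf (a * spec q t v i) q / qpochInf (a * x i) q := by
  have h (m : ℕ) : ∑ u ∈ Finset.piAntidiag Finset.univ m,
      a ^ wt u * qbin q t M u v * eval x (MM q t M u) = eval x (MM q t M v) *
        (PowerSeries.coeff m (PowerSeries.X ^ wt v * ∏ i, qser q (x i) (spec q t v i)) * a ^ m) := by
    rw [← mul_assoc, ← sum_qbin_mul_eval_MM hg hq hM, Finset.sum_mul]
    refine Finset.sum_congr rfl fun u hu => ?_
    rw [show wt u = m from (Finset.mem_piAntidiag.1 hu).1]
    ring
  rw [tsum_eq_tsum_piAntidiag hs.of_norm, tsum_congr h, tsum_mul_left, ((sumsTo_X_pow a (wt v)).mul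
    (SumsTo.prod Finset.univ fun i => sumsTo_qser hq (ha i))).2]
  ring

end Summation

/-- **gl_n q-binomial theorem I** (Theorem 4.1). -/
theorem gln_q_binomial_theorem_I
    (hn : 0 < n) (q t : ℂ) (hq0 : q ≠ 0) (hq1 : ‖q‖ < 1) (ht : t ≠ 0)
    (hqt : ∀ i j : ℤ, ¬(i = 0 ∧ j = 0) → q ^ i * t ^ j ≠ 1)
    (M : (Fin n → ℕ) → MvPolynomial (Fin n) ℂ) (hM : IsInterpFamily q t M)
    (v : Fin n → ℕ) (x : Fin n → ℂ) :
    ∃ ε > 0, ∀ a : ℂ, ‖a‖ < ε →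
      Summable (fun u : Fin n → ℕ =>
        ‖a ^ wt u * qbin q t M u v * eval x (MM q t M u)‖) ∧
      ∑' u : Fin n → ℕ, a ^ wt u * qbin q t M u v * eval x (MM q t M u) =
        a ^ wt v * eval x (MM q t M v) *
          ∏ i, qpochInf (a * spec q t v i) q / qpochInf (a * x i) q := by
  obtain ⟨N, rfl⟩ := Nat.exists_eq_succ_of_ne_zero hn.ne'
  have hg : IsGeneric q t := ⟨hq0, ht, hqt⟩
  obtain ⟨K, hK, hK'⟩ := exists_summable hg hq1 hM v x
  have hD (i : Fin (N + 1)) : 0 ≤ (‖x i‖ + ‖spec q t v i‖) / (1 - ‖q‖) :=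
    div_nonneg (by positivity) (sub_pos.2 hq1).le
  set D := ∑ i, (‖x i‖ + ‖spec q t v i‖) / (1 - ‖q‖)
  have hD0 : 0 ≤ D := Finset.sum_nonneg fun i _ => hD i
  have hpos : 0 < K + D + 1 := by linarith
  refine ⟨(K + D + 1)⁻¹, inv_pos.2 hpos, fun a ha => ?_⟩
  have hlt {c : ℝ} (hc : c ≤ K + D) : c * ‖a‖ < 1 := by
    rw [← one_div, lt_div_iff₀ hpos] at ha
    nlinarith [norm_nonneg a]
  have hs := hK' a (hlt (by linarith))
  refine ⟨hs, tsum_qbin_mul_eval_MM hg hq1 hM v x hs fun i => hlt ?_⟩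
  linarith [Finset.single_le_sum (fun i _ => hD i) (Finset.mem_univ i)]

end LRW
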